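/- arXiv:math/0402008 — 2 statements merged into one kernel-verified Lean document; each statement's English description precedes it below -/
import Mathlib

section
/- Let D be a domain in ℂⁿ and let ψ : D → ℂ be a continuous function that is holomorphic on D ∖ ψ⁻¹({0}). If ψ vanishes on a subset of D that is not pluripolar in ℂⁿ, then ψ ≡ 0 on D. -/
open Metric Set Polynomial

noncomputable section

/-- A function `u : ℂ → EReal` is subharmonic on an open set `U` if it is upper
semicontinuous on `U` and satisfies the maximum principle with respect to harmonic
majorants of the form `Re p`, `p` a complex polynomial, on every closed disc in `U`. -/
def SubharmonicOn (u : ℂ → EReal) (U : Set ℂ) : Prop :=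
  UpperSemicontinuousOn u U ∧
    ∀ (c : ℂ) (r : ℝ), 0 < r → closedBall c r ⊆ U →
      ∀ p : Polynomial ℂ,
        (∀ z ∈ sphere c r, u z ≤ (((p.eval z).re : ℝ) : EReal)) →
        ∀ z ∈ closedBall c r, u z ≤ (((p.eval z).re : ℝ) : EReal)

/-- `u : ℂ^N → [-∞, ∞)` is plurisubharmonic if it is upper semicontinuous, takes values
in `[-∞, ∞)`, and its restriction to every complex affine line is subharmonic. -/
def Plurisubharmonic {N : ℕ} (u : (Fin N → ℂ) → EReal) : Prop :=
  UpperSemicontinuous u ∧ (∀ z, u z ≠ ⊤) ∧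
    ∀ a b : Fin N → ℂ, SubharmonicOn (fun t : ℂ => u (a + t • b)) Set.univ

/-- A set `E ⊆ ℂ^N` is pluripolar if there is a plurisubharmonic function on `ℂ^N`,
not identically `-∞`, which is `-∞` on `E`. -/
def Pluripolar {N : ℕ} (E : Set (Fin N → ℂ)) : Prop :=
  ∃ u : (Fin N → ℂ) → EReal,
    Plurisubharmonic u ∧ ¬ (∀ z, u z = ⊥) ∧ ∀ z ∈ E, u z = ⊥

lemma rado_max {f h : ℂ → ℂ} (hf : ContinuousOn f (closedBall 0 1))
    (hd : ∀ z ∈ ball (0:ℂ) 1, f z ≠ 0 → DifferentiableAt ℂ f z)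
    (hh : DiffContOnCl ℂ h {z ∈ ball (0:ℂ) 1 | f z ≠ 0}) {M : ℝ} (hM0 : 0 < M)
    (hM : ∀ z ∈ sphere (0:ℂ) 1, z ∈ closure {z ∈ ball (0:ℂ) 1 | f z ≠ 0} → ‖h z‖ ≤ M) :
    ∀ α ∈ {z ∈ ball (0:ℂ) 1 | f z ≠ 0}, ‖h α‖ ≤ M := by
  set Ω := {z ∈ ball (0:ℂ) 1 | f z ≠ 0} with hΩ
  have hΩo : IsOpen Ω := by
    have := (hf.mono ball_subset_closedBall).isOpen_inter_preimage isOpen_ball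
      (isOpen_compl_singleton (x := (0:ℂ)))
    exact this
  have hcl : closure Ω ⊆ closedBall 0 1 :=
    closure_minimal (fun z hz => ball_subset_closedBall hz.1) isClosed_closedBall
  have hfd : DiffContOnCl ℂ f Ω :=
    ⟨fun z hz => (hd z hz.1 hz.2).differentiableWithinAt, hf.mono hcl⟩
  obtain ⟨B, hB⟩ := (isCompact_closedBall (0:ℂ) 1).exists_bound_of_continuousOn hf
  have hB0 : 0 ≤ B := (norm_nonneg _).trans (hB 0 (by simp))
  intro α hα
  have key : ∀ j : ℕ, ‖h α‖ ^ j * ‖f α‖ ≤ M ^ j * B := by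
    intro j
    have hd' : DiffContOnCl ℂ (fun z => h z ^ j * f z) Ω := by
      refine ⟨?_, ?_⟩
      · exact (hh.differentiableOn.pow j).mul hfd.differentiableOn
      · exact (hh.continuousOn.pow j).mul hfd.continuousOn
    have := Complex.norm_le_of_forall_mem_frontier_norm_le (U := Ω) (C := M ^ j * B)
      (isBounded_ball.subset (fun z hz => hz.1)) hd' ?_ (subset_closure hα)
    · simpa using this
    · intro z hz
      have hzc : z ∈ closure Ω := hz.1
      have hzn : z ∉ Ω := by rw [hΩo.frontier_eq] at hz; exact hz.2
      by_cases h0 : f z = 0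
      · simp only [h0, mul_zero, norm_zero]; positivity
      · have hs : z ∈ sphere (0:ℂ) 1 := by
          have h1 := hcl hzc
          have h2 : z ∉ ball (0:ℂ) 1 := fun h => hzn ⟨h, h0⟩
          simp at h1 h2 ⊢; linarith
        rw [norm_mul, norm_pow]
        have := hM z hs hzc
        have := hB z (hcl hzc)
        gcongr
  by_contra hcon
  push Not at hcon
  have hr : 1 < ‖h α‖ / M := (one_lt_div hM0).2 hcon
  have hfp : 0 < ‖f α‖ := norm_pos_iff.2 hα.2
  obtain ⟨j, hj⟩ := pow_unbounded_of_one_lt (B / ‖f α‖) hr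
  have := key j
  rw [div_pow, div_lt_div_iff₀ hfp (by positivity)] at hj
  linarith

/-- density -/
lemma rado_dense {f : ℂ → ℂ} (hf : ContinuousOn f (closedBall 0 1))
    (hd : ∀ z ∈ ball (0:ℂ) 1, f z ≠ 0 → DifferentiableAt ℂ f z)
    {z0 : ℂ} (hz0 : z0 ∈ ball (0:ℂ) 1) (hfz : f z0 ≠ 0) :
    ball (0:ℂ) 1 ⊆ closure {z ∈ ball (0:ℂ) 1 | f z ≠ 0} := by
  set Ω := {z ∈ ball (0:ℂ) 1 | f z ≠ 0} with hΩ
  by_contra hcon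
  obtain ⟨x, hx, hxn⟩ := not_subset.1 hcon
  -- the boundary point
  have hpre : IsPreconnected (ball (0:ℂ) 1) := (convex_ball _ _).isPreconnected
  have : ∃ b ∈ ball (0:ℂ) 1, b ∈ closure Ω ∧ b ∈ closure (closure Ω)ᶜ := by
    by_contra hno
    push Not at hno
    have := hpre (closure Ω)ᶜ (closure (closure Ω)ᶜ)ᶜ isClosed_closure.isOpen_compl
      isClosed_closure.isOpen_compl ?_ ⟨x, hx, hxn⟩ ⟨z0, hz0, ?_⟩
    · obtain ⟨y, -, h1, h2⟩ := this
      exact h2 (subset_closure h1)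
    · intro b hb
      by_cases h : b ∈ closure Ω
      · exact Or.inr (hno b hb h)
      · exact Or.inl h
    · exact hno z0 hz0 (subset_closure ⟨hz0, hfz⟩)
  obtain ⟨b, hb, hb1, hb2⟩ := this
  have hb' : ‖b‖ < 1 := by simpa using hb
  set δ := (1 - ‖b‖) / 4 with hδ
  have hδ0 : 0 < δ := by rw [hδ]; linarith
  obtain ⟨α, hα, hαb⟩ := Metric.mem_closure_iff.1 hb1 δ hδ0
  obtain ⟨c, hc, hcb⟩ := Metric.mem_closure_iff.1 hb2 δ hδ0
  have hcn : ‖c‖ ≤ 1 - 3 * δ := by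
    have h1 : ‖c‖ ≤ ‖b‖ + dist b c := by
      rw [dist_comm, dist_eq_norm]
      simpa using norm_add_le b (c - b)
    linarith
  have hne : ∀ z ∈ closure Ω, z - c ≠ 0 := by
    intro z hz h
    rw [sub_eq_zero] at h; subst h; exact hc hz
  have := rado_max (h := fun z => (z - c)⁻¹) hf hd ?_ (M := (3 * δ)⁻¹) (by positivity) ?_ α hα
  · rw [norm_inv] at this
    have hpos : 0 < ‖α - c‖ := norm_pos_iff.2 (hne α (subset_closure hα))
    rw [inv_le_inv₀ hpos (by positivity)] at this
    have h2 := dist_triangle_left α c b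
    rw [dist_eq_norm] at h2
    linarith
  · exact ⟨fun z hz => ((differentiableAt_id.sub_const c).inv
      (hne z (subset_closure hz))).differentiableWithinAt,
      (continuousOn_id.sub continuousOn_const).inv₀ hne⟩
  · intro z hz _
    rw [norm_inv]
    have h1 : ‖z‖ = 1 := by simpa using hz
    have h2 := norm_sub_norm_le z c
    gcongr
    linarith

/-- trigonometric approximation -/
lemma exists_poly_approx {u : ℂ → ℝ} (hu : ContinuousOn u (sphere 0 1)) {ε : ℝ} (hε : 0 < ε) :
    ∃ q : ℂ[X], ∀ z ∈ sphere (0:ℂ) 1, |u z - (q.eval z).re| ≤ ε := by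
  have : Fact (0 < 2 * Real.pi) := ⟨by positivity⟩
  let g : C(AddCircle (2 * Real.pi), ℂ) :=
    ⟨fun θ => (u (AddCircle.toCircle θ : ℂ) : ℂ), by
      refine Complex.continuous_ofReal.comp ?_
      refine hu.comp_continuous (by fun_prop) ?_
      intro x; simp [Circle.norm_coe]⟩
  have hg : g ∈ (Submodule.span ℂ (range <| @fourier (2 * Real.pi))).topologicalClosure := by
    rw [span_fourier_closure_eq_top]; trivial
  obtain ⟨t, ht, htg⟩ := Metric.mem_closure_iff.1 hg ε hε
  have : ∃ p1 p2 : ℂ[X], ∀ θ : AddCircle (2 * Real.pi),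
      t θ = p1.eval (AddCircle.toCircle θ : ℂ) + (starRingEnd ℂ) (p2.eval (AddCircle.toCircle θ : ℂ)) := by
    clear htg
    induction ht using Submodule.span_induction with
    | mem x hx =>
      obtain ⟨n, rfl⟩ := hx
      rcases Int.eq_nat_or_neg n with ⟨k, rfl | rfl⟩
      · refine ⟨X ^ k, 0, fun θ => ?_⟩
        simp [fourier_apply, AddCircle.toCircle_nsmul]
      · refine ⟨0, X ^ k, fun θ => ?_⟩
        rw [fourier_neg]
        simp [fourier_apply, AddCircle.toCircle_nsmul]
    | zero => exact ⟨0, 0, by simp⟩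
    | add x y _ _ hx hy =>
      obtain ⟨a, b, h⟩ := hx
      obtain ⟨a', b', h'⟩ := hy
      refine ⟨a + a', b + b', fun θ => ?_⟩
      simp [h, h']; ring
    | smul c x _ hx =>
      obtain ⟨a, b, h⟩ := hx
      refine ⟨C c * a, C ((starRingEnd ℂ) c) * b, fun θ => ?_⟩
      simp [h]; ring
  obtain ⟨p1, p2, hp⟩ := this
  refine ⟨p1 + p2, fun z hz => ?_⟩
  have hz1 : ‖z‖ = 1 := by simpa using hz
  obtain ⟨θ, hθ⟩ : ∃ θ : AddCircle (2 * Real.pi), (AddCircle.toCircle θ : ℂ) = z := by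
    refine ⟨((Complex.arg z : ℝ) : AddCircle (2 * Real.pi)), ?_⟩
    rw [AddCircle.toCircle_apply_mk]
    have := Complex.norm_mul_exp_arg_mul_I z
    rw [hz1] at this
    simp only [Circle.coe_exp]
    rw [div_self (by positivity), one_mul]
    simpa using this
  have h1 : dist (g θ) (t θ) < ε := (ContinuousMap.dist_lt_iff hε).1 htg θ
  have h2 : (g θ) = (u z : ℂ) := by simp [g, hθ]
  rw [h2, hp, hθ, dist_eq_norm] at h1
  have h3 := Complex.abs_re_le_norm ((u z : ℂ) - (p1.eval z + (starRingEnd ℂ) (p2.eval z)))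
  simp only [Complex.sub_re, Complex.ofReal_re, Complex.add_re, Complex.conj_re] at h3
  simp only [eval_add, Complex.add_re]
  linarith

lemma rado_approx {f : ℂ → ℂ} (hf : ContinuousOn f (closedBall 0 1))
    (hd : ∀ z ∈ ball (0:ℂ) 1, f z ≠ 0 → DifferentiableAt ℂ f z)
    {z0 : ℂ} (hz0 : z0 ∈ ball (0:ℂ) 1) (hfz : f z0 ≠ 0) (q : ℂ[X]) {ε : ℝ}
    (hq : ∀ z ∈ sphere (0:ℂ) 1, |(f z).re - (q.eval z).re| ≤ ε) :
    ∀ z ∈ ball (0:ℂ) 1, |(f z).re - (q.eval z).re| ≤ ε := by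
  set Ω := {z ∈ ball (0:ℂ) 1 | f z ≠ 0} with hΩ
  have hcl : closure Ω ⊆ closedBall 0 1 :=
    closure_minimal (fun z hz => ball_subset_closedBall hz.1) isClosed_closedBall
  have h1 : ∀ z ∈ Ω, |(f z).re - (q.eval z).re| ≤ ε := by
    intro z hz
    have hfd : DiffContOnCl ℂ f Ω :=
      ⟨fun z hz => (hd z hz.1 hz.2).differentiableWithinAt, hf.mono hcl⟩
    have hqd : DiffContOnCl ℂ (fun z => q.eval z) Ω := q.differentiable.diffContOnCl
    have hA := rado_max (h := fun z => Complex.exp (f z - q.eval z)) hf hd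
      ⟨(hfd.sub hqd).differentiableOn.cexp, (hfd.sub hqd).continuousOn.cexp⟩
      (M := Real.exp ε) (Real.exp_pos _) ?_ z hz
    · have hB := rado_max (h := fun z => Complex.exp (q.eval z - f z)) hf hd
        ⟨(hqd.sub hfd).differentiableOn.cexp, (hqd.sub hfd).continuousOn.cexp⟩
        (M := Real.exp ε) (Real.exp_pos _) ?_ z hz
      · simp only [Complex.norm_exp, Real.exp_le_exp, Complex.sub_re] at hA hB
        rw [abs_le]; constructor <;> linarith
      · intro w hw _
        have := abs_le.1 (hq w hw)
        simp only [Complex.norm_exp, Real.exp_le_exp, Complex.sub_re]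
        linarith
    · intro w hw _
      have := abs_le.1 (hq w hw)
      simp only [Complex.norm_exp, Real.exp_le_exp, Complex.sub_re]
      linarith
  intro z hz
  have hz' := rado_dense hf hd hz0 hfz hz
  have hc : ContinuousOn (fun z => |(f z).re - (q.eval z).re|) (closure Ω) := by
    have hf' := hf.mono hcl
    have : ContinuousOn (fun z => q.eval z) (closure Ω) := q.continuous.continuousOn
    exact ((Complex.continuous_re.comp_continuousOn hf').sub
      (Complex.continuous_re.comp_continuousOn this)).abs
  exact le_on_closure h1 hc continuousOn_const hz'

lemma rado_re {f : ℂ → ℂ} (hf : ContinuousOn f (closedBall 0 1))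
    (hd : ∀ z ∈ ball (0:ℂ) 1, f z ≠ 0 → DifferentiableAt ℂ f z)
    {z0 : ℂ} (hz0 : z0 ∈ ball (0:ℂ) 1) (hfz : f z0 ≠ 0) :
    ∃ Q : ℂ → ℂ, AnalyticOnNhd ℂ Q (ball 0 1) ∧ ∀ z ∈ ball (0:ℂ) 1, (Q z).re = (f z).re := by
  have hfs : ContinuousOn (fun z => (f z).re) (sphere (0:ℂ) 1) :=
    Complex.continuous_re.comp_continuousOn (hf.mono sphere_subset_closedBall)
  have hi : CircleIntegrable (fun z => (f z).re) 0 1 := hfs.circleIntegrable (by norm_num)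
  have hi' : CircleIntegrable (fun z => ((f z).re : ℂ)) 0 1 :=
    (Complex.continuous_ofReal.comp_continuousOn hfs).circleIntegrable (by norm_num)
  refine ⟨fun w => Real.circleAverage (fun ζ => herglotzRieszKernel 0 w ζ • ((f ζ).re : ℂ)) 0 1,
    analyticOnNhd_circleAverage_herglotzRieszKernel_smul hi', ?_⟩
  intro w hw
  rw [re_circleAverage_herglotzRieszKernel_smul hi hw]
  have hK : ContinuousOn (herglotzRieszKernel 0 w) (sphere (0:ℂ) 1) := by
    simpa using continuousOn_herglotzRieszKernel_sphere hw
  have hKr : ContinuousOn (Complex.re ∘ herglotzRieszKernel 0 w) (sphere (0:ℂ) 1) :=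
    Complex.continuous_re.comp_continuousOn hK
  obtain ⟨B, hB⟩ := (isCompact_sphere (0:ℂ) 1).exists_bound_of_continuousOn hKr
  have hB0 : 0 ≤ B := (norm_nonneg _).trans (hB 1 (by simp))
  have key : ∀ ε > 0, |Real.circleAverage ((Complex.re ∘ herglotzRieszKernel 0 w) • fun z => (f z).re) 0 1
      - (f w).re| ≤ ε * (B + 1) := by
    intro ε hε
    obtain ⟨q, hq⟩ := exists_poly_approx hfs hε
    have h1 := rado_approx hf hd hz0 hfz q hq w hw
    have hqc : ContinuousOn (fun z => q.eval z) (sphere (0:ℂ) 1) := q.continuous.continuousOn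
    have h2 : Real.circleAverage ((Complex.re ∘ herglotzRieszKernel 0 w) • fun z => (q.eval z).re) 0 1
        = (q.eval w).re := by
      have hP := DiffContOnCl.circleAverage_re_herglotzRieszKernel_smul
        (f := fun z => q.eval z) (c := 0) (R := 1) (q.differentiable.diffContOnCl) hw
      have h3 : CircleIntegrable ((Complex.re ∘ herglotzRieszKernel 0 w) • fun z => q.eval z) 0 1 :=
        (hKr.smul hqc).circleIntegrable (by norm_num)
      have h4 := Complex.reCLM.circleAverage_comp_comm h3
      rw [hP] at h4
      simp only [Complex.reCLM_apply] at h4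
      rw [← h4]
      congr 1
      ext z
      simp
    have h5 : Real.circleAverage ((Complex.re ∘ herglotzRieszKernel 0 w) • fun z => (f z).re) 0 1
      - (q.eval w).re = Real.circleAverage ((Complex.re ∘ herglotzRieszKernel 0 w) •
          fun z => ((f z).re - (q.eval z).re)) 0 1 := by
      rw [← h2, ← Real.circleAverage_sub]
      · congr 1
        ext z
        simp [mul_sub]
      · exact (hKr.smul hfs).circleIntegrable (by norm_num)
      · exact (hKr.smul (Complex.continuous_re.comp_continuousOn hqc)).circleIntegrable (by norm_num)
    have h6 : |Real.circleAverage ((Complex.re ∘ herglotzRieszKernel 0 w) •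
          fun z => ((f z).re - (q.eval z).re)) 0 1| ≤ B * ε := by
      refine Real.abs_circleAverage_le_circleAverage_abs.trans ?_
      refine Real.circleAverage_mono_on_of_le_circle ?_ ?_
      · refine ContinuousOn.circleIntegrable (by norm_num) ?_
        exact (hKr.smul (hfs.sub (Complex.continuous_re.comp_continuousOn hqc))).abs
      · intro z hz
        have hz' : z ∈ sphere (0:ℂ) 1 := by simpa using hz
        have := hB z hz'
        have := hq z hz'
        change |(Complex.re ∘ herglotzRieszKernel 0 w) z * ((f z).re - (q.eval z).re)| ≤ B * ε
        rw [abs_mul]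
        rw [Real.norm_eq_abs] at *
        gcongr
    rw [← h5] at h6
    have := abs_le.1 h6
    have := abs_le.1 h1
    rw [abs_le]; constructor <;> nlinarith
  rw [← sub_eq_zero, ← abs_nonpos_iff]
  refine le_of_forall_pos_le_add fun η hη => ?_
  have := key (η / (B + 1)) (by positivity)
  rw [div_mul_cancel₀ _ (by positivity)] at this
  linarith

lemma rado_unit {f : ℂ → ℂ} (hf : ContinuousOn f (closedBall 0 1))
    (hd : ∀ z ∈ ball (0:ℂ) 1, f z ≠ 0 → DifferentiableAt ℂ f z) :
    DifferentiableOn ℂ f (ball 0 1) := by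
  by_cases hz : ∃ z0 ∈ ball (0:ℂ) 1, f z0 ≠ 0
  swap
  · push Not at hz
    exact (differentiableOn_const (0:ℂ)).congr hz
  obtain ⟨z0, hz0, hfz⟩ := hz
  obtain ⟨Q, hQ, hQf⟩ := rado_re hf hd hz0 hfz
  obtain ⟨S, hS, hSf⟩ := rado_re (f := fun z => -Complex.I * f z) (continuousOn_const.mul hf)
    (fun z hz h => (hd z hz (by simpa using h)).const_mul _) hz0 (by simpa using hfz)
  have hSf' : ∀ z ∈ ball (0:ℂ) 1, (S z).re = (f z).im := by
    intro z hz; rw [hSf z hz]; simp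
  have hΩo : IsOpen {z ∈ ball (0:ℂ) 1 | f z ≠ 0} :=
    (hf.mono ball_subset_closedBall).isOpen_inter_preimage isOpen_ball
      (isOpen_compl_singleton (x := (0:ℂ)))
  obtain ⟨r, hr, hrΩ⟩ := Metric.isOpen_iff.1 hΩo z0 ⟨hz0, hfz⟩
  have hfr : AnalyticOnNhd ℂ f (ball z0 r) :=
    DifferentiableOn.analyticOnNhd
      (fun z hz => (hd z (hrΩ hz).1 (hrΩ hz).2).differentiableWithinAt) isOpen_ball
  have hsub : ball z0 r ⊆ ball 0 1 := fun z hz => (hrΩ hz).1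
  have hpre : IsConnected (ball z0 r) :=
    (convex_ball _ _).isConnected (nonempty_ball.2 hr)
  obtain ⟨c1, hc1⟩ := AnalyticOnNhd.eq_const_of_re_eq_const (U := ball z0 r) (c₀ := 0)
    (f := fun z => f z - Q z) (hfr.sub (hQ.mono hsub))
    (fun z hz => by simp [hQf z (hsub hz)]) isOpen_ball hpre
  obtain ⟨c2, hc2⟩ := AnalyticOnNhd.eq_const_of_re_eq_const (U := ball z0 r) (c₀ := c1.im)
    (f := fun z => S z + Complex.I * Q z) ((hS.mono hsub).add (analyticOnNhd_const.mul (hQ.mono hsub)))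
    (fun z hz => by
      have h1 := hc1 z hz
      have h2 := congrArg Complex.im h1
      simp at h2
      simp [hSf' z (hsub hz)]; linarith) isOpen_ball hpre
  have hid : EqOn (fun z => S z + Complex.I * Q z) (fun _ => c2) (ball 0 1) := by
    refine AnalyticOnNhd.eqOn_of_preconnected_of_eventuallyEq
      (hS.add (analyticOnNhd_const.mul hQ)) analyticOnNhd_const
      (convex_ball _ _).isPreconnected hz0 ?_
    filter_upwards [ball_mem_nhds z0 hr] with z hz using hc2 z hz
  have hfin : ∀ z ∈ ball (0:ℂ) 1, f z = Q z + Complex.I * (c2.re : ℂ) := by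
    intro z hz
    have h1 := congrArg Complex.re (hid hz)
    simp at h1
    rw [hSf' z hz] at h1
    apply Complex.ext
    · simp [hQf z hz]
    · simp; linarith
  exact (hQ.differentiableOn.add_const _).congr hfin

/-- The theorem of Rado on an arbitrary open set. -/
lemma rado {f : ℂ → ℂ} {U : Set ℂ} (hU : IsOpen U) (hf : ContinuousOn f U)
    (hd : ∀ z ∈ U, f z ≠ 0 → DifferentiableAt ℂ f z) : DifferentiableOn ℂ f U := by
  intro c hc
  obtain ⟨r, hr, hrU⟩ := Metric.nhds_basis_closedBall.mem_iff.1 (hU.mem_nhds hc)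
  have hr' : (r : ℂ) ≠ 0 := by exact_mod_cast hr.ne'
  have hm : MapsTo (fun t : ℂ => c + r * t) (closedBall 0 1) (closedBall c r) := by
    intro t ht
    simp at ht ⊢
    rw [abs_of_pos hr]; nlinarith
  have h := rado_unit (f := fun t => f (c + r * t)) (hf.comp (by fun_prop) (hm.mono_right hrU))
    (fun z hz h => by
      have := hd _ (hrU (hm (ball_subset_closedBall hz))) h
      exact DifferentiableAt.comp z this (by fun_prop))
  have h0 := (h 0 (by simp)).differentiableAt (ball_mem_nhds 0 one_pos)
  have h1 : f = (fun t => f (c + r * t)) ∘ (fun z => (z - c) / r) := by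
    ext z; simp [mul_div_cancel₀ _ hr']
  rw [h1]
  refine (DifferentiableAt.comp c ?_ (by fun_prop)).differentiableWithinAt
  simpa using h0

lemma moment_bound {q h : ℂ → ℂ} (hq : ContinuousOn q (sphere 0 1))
    (hh : DiffContOnCl ℂ h (ball 0 2)) {B S : ℝ} (hB : ∀ z ∈ sphere (0:ℂ) 2, ‖h z‖ ≤ B)
    (hS : ∀ j : ℕ, ‖∮ z in C(0, 1), q z * z ^ j‖ ≤ S) :
    ‖∮ z in C(0, 1), q z * h z‖ ≤ 2 * B * S := by
  obtain ⟨K, hK⟩ := (isCompact_sphere (0:ℂ) 1).exists_bound_of_continuousOn hq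
  have hB0 : 0 ≤ B := (norm_nonneg _).trans (hB 2 (by simp))
  have hK0 : 0 ≤ K := (norm_nonneg _).trans (hK 1 (by simp))
  have hS0 : 0 ≤ S := (norm_nonneg _).trans (hS 0)
  set a : ℕ → ℂ := fun j => (j.factorial : ℂ)⁻¹ * iteratedDeriv j h 0 with ha
  have hab : ∀ j, ‖a j‖ ≤ B * (1 / 2) ^ j := by
    intro j
    have := Complex.norm_iteratedDeriv_le_of_forall_mem_sphere_norm_le j (by norm_num : (0:ℝ) < 2)
      hh hB
    have hj : (0:ℝ) < j.factorial := by positivity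
    simp only [ha, norm_mul, norm_inv, Complex.norm_natCast]
    rw [inv_mul_le_iff₀ hj]
    refine this.trans (le_of_eq ?_)
    rw [one_div, inv_pow]; ring
  have hsum : ∀ z ∈ sphere (0:ℂ) 1, HasSum (fun j => a j * z ^ j) (h z) := by
    intro z hz
    have hz2 : z ∈ ball (0:ℂ) (2:NNReal) := by
      have : ‖z‖ = 1 := by simpa using hz
      simp [this]
    have := Complex.hasSum_taylorSeries_on_ball (f := h) (c := 0) (r := 2) hh.differentiableOn hz2
    have he : (fun j => a j * z ^ j) =
        fun n : ℕ => (n.factorial : ℂ)⁻¹ • (z - 0) ^ n • iteratedDeriv n h 0 := by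
      ext j; simp [ha]; ring
    rw [he]; exact this
  have hg : Summable (fun j : ℕ => B * (1 / 2 : ℝ) ^ j) :=
    (summable_geometric_of_lt_one (by norm_num) (by norm_num)).mul_left _
  have hmem : ∀ θ : ℝ, circleMap 0 1 θ ∈ sphere (0:ℂ) 1 := fun θ => by simp [circleMap_zero]
  have hnc : ∀ θ : ℝ, ‖circleMap 0 1 θ‖ = 1 := fun θ => by simpa using hmem θ
  have hqc : Continuous fun θ => q (circleMap 0 1 θ) :=
    hq.comp_continuous (continuous_circleMap 0 1) hmem
  have main : HasSum (fun j : ℕ => ∮ z in C(0, 1), q z * (a j * z ^ j)) (∮ z in C(0, 1), q z * h z) := by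
    unfold circleIntegral
    refine intervalIntegral.hasSum_integral_of_dominated_convergence
      (fun j _ => K * (B * (1 / 2 : ℝ) ^ j)) ?_ ?_ ?_ ?_ ?_
    · intro j
      refine Continuous.aestronglyMeasurable ?_
      simp only [deriv_circleMap]
      have hcm := continuous_circleMap 0 1
      exact (hcm.mul continuous_const).smul (hqc.mul (continuous_const.mul (hcm.pow j)))
    · intro j
      refine Filter.Eventually.of_forall fun θ _ => ?_
      have h1 := hab j
      have h2 := hK _ (hmem θ)
      simp only [smul_eq_mul, norm_mul, norm_pow, hnc, deriv_circleMap, Complex.norm_I]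
      simp only [one_pow, mul_one, one_mul]
      gcongr
    · exact Filter.Eventually.of_forall fun θ _ => hg.mul_left _
    · exact intervalIntegrable_const
    · refine Filter.Eventually.of_forall fun θ _ => ?_
      exact ((hsum _ (hmem θ)).mul_left _).const_smul _
  rw [← main.tsum_eq]
  have hb : ∀ j : ℕ, ‖∮ z in C(0, 1), q z * (a j * z ^ j)‖ ≤ B * (1 / 2) ^ j * S := by
    intro j
    have : (∮ z in C(0, 1), q z * (a j * z ^ j)) = a j * ∮ z in C(0, 1), q z * z ^ j := by
      rw [← circleIntegral.integral_const_mul]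
      congr 1; ext z; ring
    rw [this, norm_mul]
    exact mul_le_mul (hab j) (hS j) (norm_nonneg _) (by positivity)
  refine (tsum_of_norm_bounded ?_ hb)
  have h2 := (hasSum_geometric_of_lt_one (r := (1/2:ℝ)) (by norm_num) (by norm_num)).mul_left B
  have h3 := h2.mul_right S
  have he : B * (1 - 1 / 2 : ℝ)⁻¹ * S = 2 * B * S := by
    rw [show (1 - 1 / 2 : ℝ)⁻¹ = 2 by norm_num]; ring
  rwa [he] at h3

lemma eval_bound {F P : ℂ → ℂ} {s : ℕ} (hs : 1 ≤ s) (hF : DiffContOnCl ℂ F (ball 0 2))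
    (hFs : ∀ w ∈ closedBall (0:ℂ) 2, ‖F w - w ^ s‖ ≤ 1 / 4) (hP : Differentiable ℂ P)
    {w0 : ℂ} (hw0 : w0 ∈ closedBall (0:ℂ) 2) (hFw : F w0 = 0) {S : ℝ} 
    (hS : ∀ j < s, ‖∮ z in C(0, 1), P z * z ^ j / F z‖ ≤ S) :
    ‖P w0‖ ≤ 2 * (2 ^ s + 1) * S := by
  have hw1 : ‖w0‖ < 1 := by
    have := hFs w0 hw0
    rw [hFw, zero_sub, norm_neg, norm_pow] at this
    by_contra hc
    push Not at hc
    have := one_le_pow₀ (n := s) hc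
    linarith
  have hS0 : 0 ≤ S := (norm_nonneg _).trans (hS 0 (by omega))
  have hsub : sphere (0:ℂ) 1 ⊆ closedBall 0 2 := by
    intro z hz; simp at hz ⊢; rw [hz]; norm_num
  have hFlow : ∀ z ∈ sphere (0:ℂ) 1, 3 / 4 ≤ ‖F z‖ := by
    intro z hz
    have h1 : ‖z‖ = 1 := by simpa using hz
    have h2 := hFs z (hsub hz)
    have h3 : ‖z ^ s‖ = 1 := by simp [h1]
    have h4 := norm_sub_norm_le (z ^ s) (F z)
    rw [norm_sub_rev] at h4
    linarith
  have hF0 : ∀ z ∈ sphere (0:ℂ) 1, F z ≠ 0 := by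
    intro z hz h
    have := hFlow z hz
    rw [h, norm_zero] at this; linarith
  have hFc : ContinuousOn F (closedBall 0 2) := by
    have := hF.continuousOn
    rwa [closure_ball _ (by norm_num)] at this
  have hqc : ContinuousOn (fun z => P z / F z) (sphere 0 1) :=
    hP.continuous.continuousOn.div (hFc.mono hsub) hF0
  obtain ⟨K, hK⟩ := (isCompact_sphere (0:ℂ) 1).exists_bound_of_continuousOn hqc
  set T := 2 * Real.pi * 1 * K with hT
  have hMT : ∀ j : ℕ, ‖∮ z in C(0, 1), P z / F z * z ^ j‖ ≤ T := by
    intro j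
    refine circleIntegral.norm_integral_le_of_norm_le_const (by norm_num) fun z hz => ?_
    have h1 : ‖z‖ = 1 := by simpa using hz
    rw [norm_mul, norm_pow, h1, one_pow, mul_one]
    exact hK z hz
  have hT0 : 0 ≤ T := (norm_nonneg _).trans (hMT 0)
  have step : ∀ i : ℕ, ∀ j : ℕ, ‖∮ z in C(0, 1), P z / F z * z ^ j‖ ≤ max S (T * (1 / 2) ^ i) := by
    intro i
    induction i with
    | zero => intro j; simpa using Or.inr (hMT j)
    | succ i ih =>
      intro j
      by_cases hj : j < s
      · refine le_trans (le_of_eq ?_) ((hS j hj).trans (le_max_left _ _))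
        congr 2; ext z; ring
      · push Not at hj
        obtain ⟨k, rfl⟩ := Nat.exists_eq_add_of_le hj
        have hX := moment_bound (q := fun z => P z / F z * z ^ k) (h := fun z => F z - z ^ s)
          (B := 1 / 4) (S := max S (T * (1 / 2) ^ i))
          (hqc.mul (by fun_prop)) (hF.sub (by
            exact (differentiable_id.pow s).diffContOnCl)) 
          (fun z hz => hFs z (sphere_subset_closedBall hz)) (fun j => by
            have := ih (k + j)
            simpa only [pow_add, mul_assoc] using this)
        have heq : (∮ z in C(0, 1), P z / F z * z ^ (s + k)) =
            - ∮ z in C(0, 1), P z / F z * z ^ k * (F z - z ^ s) := by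
          have hC : (∮ z in C(0, 1), P z * z ^ k) = 0 := by
            apply Complex.circleIntegral_eq_zero_of_differentiable_on_off_countable (by norm_num) countable_empty
            · exact (hP.continuous.mul (by fun_prop)).continuousOn
            · intro z _
              exact (hP z).mul (by fun_prop)
          rw [← sub_eq_zero, sub_neg_eq_add, ← circleIntegral.integral_add]
          · refine Eq.trans ?_ hC
            refine circleIntegral.integral_congr (by norm_num) fun z hz => ?_
            have := hF0 z hz
            field_simp
            ring
          · exact (hqc.mul (by fun_prop)).circleIntegrable (by norm_num)
          · exact ((hqc.mul (by fun_prop)).mul ((hFc.mono hsub).sub (by fun_prop))).circleIntegrable (by norm_num)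
        rw [heq, norm_neg]
        refine hX.trans ?_
        rw [show 2 * (1 / 4 : ℝ) * max S (T * (1 / 2) ^ i) = max S (T * (1 / 2) ^ i) * (1 / 2) by ring,
          max_mul_of_nonneg _ _ (by norm_num)]
        apply max_le_max
        · linarith
        · rw [pow_succ]; linarith
  have hall : ∀ j : ℕ, ‖∮ z in C(0, 1), P z / F z * z ^ j‖ ≤ S := by
    intro j
    have hlim : Filter.Tendsto (fun i : ℕ => max S (T * (1 / 2 : ℝ) ^ i)) Filter.atTop (nhds (max S (T * 0))) :=
      tendsto_const_nhds.max ((tendsto_pow_atTop_nhds_zero_of_lt_one (by norm_num) (by norm_num)).const_mul T)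
    have := ge_of_tendsto' hlim (fun i => step i j)
    simpa [hS0] using this
  have hw2 : ball (0:ℂ) 2 ∈ nhds w0 := isOpen_ball.mem_nhds (by simp; linarith)
  have hw2' : closedBall (0:ℂ) 2 ∈ nhds w0 := Filter.mem_of_superset hw2 ball_subset_closedBall
  have hgd : DiffContOnCl ℂ (dslope F w0) (ball 0 2) := by
    refine ⟨(Complex.differentiableOn_dslope hw2).2 hF.differentiableOn, ?_⟩
    rw [closure_ball _ (by norm_num)]
    exact (continuousOn_dslope hw2').2 ⟨hFc, (hF.differentiableOn.differentiableAt hw2)⟩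
  have hgz : ∀ z, z ≠ w0 → dslope F w0 z = F z / (z - w0) := by
    intro z hz
    rw [dslope_of_ne _ hz, slope_def_field, hFw, sub_zero]
  have hg2 : ∀ z ∈ sphere (0:ℂ) 2, ‖dslope F w0 z‖ ≤ 2 ^ s + 1 := by
    intro z hz
    have hz2 : ‖z‖ = 2 := by simpa using hz
    have hne : z ≠ w0 := by rintro rfl; linarith
    rw [hgz z hne, norm_div]
    have h1 : 1 ≤ ‖z - w0‖ := by
      have := norm_sub_norm_le z w0; linarith
    have h2 : ‖F z‖ ≤ 2 ^ s + 1 := by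
      have h3 := hFs z (sphere_subset_closedBall hz)
      have h4 := norm_add_le (F z - z ^ s) (z ^ s)
      rw [sub_add_cancel, norm_pow, hz2] at h4
      linarith
    exact (div_le_self (norm_nonneg _) h1).trans h2
  have hX := moment_bound hqc hgd hg2 hall
  have hCauchy : (∮ z in C(0, 1), P z / F z * dslope F w0 z) = (2 * Real.pi * Complex.I) * P w0 := by
    have h1 := Complex.circleIntegral_sub_inv_smul_of_differentiable_on_off_countable
      (R := 1) (c := 0) (w := w0) (f := P) countable_empty (by simpa using hw1) hP.continuous.continuousOn
      (fun z _ => hP z)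
    rw [smul_eq_mul] at h1
    rw [← h1]
    refine circleIntegral.integral_congr (by norm_num) fun z hz => ?_
    have h0 := hF0 z hz
    have hne : z ≠ w0 := by
      rintro rfl
      have : ‖z‖ = 1 := by simpa using hz
      linarith
    have : z - w0 ≠ 0 := sub_ne_zero.2 hne
    simp only [hgz z hne, smul_eq_mul]
    field_simp
  rw [hCauchy, norm_mul] at hX
  have h2 : (1:ℝ) ≤ ‖(2 * Real.pi * Complex.I : ℂ)‖ := by
    simp only [norm_mul, Complex.norm_I, Complex.norm_real, Complex.norm_ofNat, mul_one, Real.norm_eq_abs,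
      abs_of_pos Real.pi_pos]
    have := Real.pi_gt_three; linarith
  nlinarith [norm_nonneg (P w0)]

lemma circle_cont {X : Type*} [TopologicalSpace X] {K : Set X} {G : ℂ → X → ℂ}
    (hG : ContinuousOn (Function.uncurry G) (sphere (0:ℂ) 1 ×ˢ K)) :
    ContinuousOn (fun x => ∮ ζ in C(0,1), G ζ x) K := by
  rw [continuousOn_iff_continuous_domRestrict]
  unfold circleIntegral
  have hmem : ∀ θ : ℝ, circleMap 0 1 θ ∈ sphere (0:ℂ) 1 := fun θ => by simp [circleMap_zero]
  refine intervalIntegral.continuous_parametric_intervalIntegral_of_continuous'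
    (f := fun (x : K) (θ : ℝ) => deriv (circleMap 0 1) θ • G (circleMap 0 1 θ) x) ?_ _ _
  simp only [deriv_circleMap]
  have h2 : Continuous fun q : K × ℝ => Function.uncurry G (circleMap 0 1 q.2, (q.1 : X)) :=
    hG.comp_continuous (by fun_prop) (fun q => ⟨hmem _, q.1.2⟩)
  have : Continuous fun q : K × ℝ => (circleMap 0 1 q.2 * Complex.I) •
    Function.uncurry G (circleMap 0 1 q.2, (q.1 : X)) :=
    (by fun_prop : Continuous fun q : K × ℝ => (circleMap 0 1 q.2 * Complex.I)).smul h2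
  exact this

lemma circle_swap {H : ℂ → ℂ → ℂ}
    (hH : ContinuousOn (Function.uncurry H) (sphere (0:ℂ) 1 ×ˢ sphere (0:ℂ) 1)) :
    (∮ a in C(0,1), ∮ b in C(0,1), H a b) = ∮ b in C(0,1), ∮ a in C(0,1), H a b := by
  have hmem : ∀ θ : ℝ, circleMap 0 1 θ ∈ sphere (0:ℂ) 1 := fun θ => by simp [circleMap_zero]
  simp only [circleIntegral, ← intervalIntegral.integral_smul]
  rw [MeasureTheory.intervalIntegral_intervalIntegral_swap]
  · congr 1; ext x; congr 1; ext y; simp only [smul_smul, mul_comm]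
  · have h2 : Continuous fun q : ℝ × ℝ => Function.uncurry H (circleMap 0 1 q.1, circleMap 0 1 q.2) :=
      hH.comp_continuous (by fun_prop) (fun q => ⟨hmem _, hmem _⟩)
    have h3 : Continuous (Function.uncurry fun x x_1 : ℝ => deriv (circleMap 0 1) x •
        deriv (circleMap 0 1) x_1 • H (circleMap 0 1 x) (circleMap 0 1 x_1)) := by
      simp only [deriv_circleMap]
      have : Continuous fun q : ℝ × ℝ => (circleMap 0 1 q.1 * Complex.I) •
        (circleMap 0 1 q.2 * Complex.I) •
        Function.uncurry H (circleMap 0 1 q.1, circleMap 0 1 q.2) :=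
        (by fun_prop : Continuous fun q : ℝ × ℝ => (circleMap 0 1 q.1 * Complex.I)).smul
          ((by fun_prop : Continuous fun q : ℝ × ℝ => (circleMap 0 1 q.2 * Complex.I)).smul h2)
      exact this
    refine (h3.continuousOn.integrableOn_compact
      (isCompact_uIcc (a := 0) (b := 2 * Real.pi) |>.prod (isCompact_uIcc (a := 0) (b := 2 * Real.pi)))).mono_set ?_
    exact prod_mono uIoc_subset_uIcc uIoc_subset_uIcc

/-- Continuous on the closed polydisc with Cauchy formula in each variable. -/
def Cls (N : ℕ) (F : (Fin N → ℂ) → ℂ) : Prop :=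
  ContinuousOn F (closedBall 0 1) ∧ ∀ i, ∀ z ∈ closedBall (0 : Fin N → ℂ) 1, ‖z i‖ < 1 →
    F z = (2 * Real.pi * Complex.I)⁻¹ * ∮ ξ in C(0,1), F (Function.update z i ξ) / (ξ - z i)

lemma update_mem {N : ℕ} {z : Fin N → ℂ} (hz : z ∈ closedBall (0 : Fin N → ℂ) 1) (i : Fin N)
    {ξ : ℂ} (hξ : ξ ∈ closedBall (0:ℂ) 1) : Function.update z i ξ ∈ closedBall (0 : Fin N → ℂ) 1 := by
  rw [mem_closedBall_zero_iff, pi_norm_le_iff_of_nonneg zero_le_one] at *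
  intro j
  by_cases h : j = i
  · subst h; simpa using hξ
  · simpa [h] using hz j

lemma sub_ne_of_sphere {ξ w : ℂ} (hξ : ξ ∈ sphere (0:ℂ) 1) (hw : ‖w‖ < 1) : ξ - w ≠ 0 := by
  intro h
  have : ξ = w := sub_eq_zero.1 h
  subst this
  simp at hξ; linarith

lemma Cls.integral {N : ℕ} {F : ℂ → (Fin N → ℂ) → ℂ}
    (hc : ContinuousOn (Function.uncurry F) (sphere (0:ℂ) 1 ×ˢ closedBall (0 : Fin N → ℂ) 1))
    (hF : ∀ ζ ∈ sphere (0:ℂ) 1, Cls N (F ζ)) :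
    Cls N (fun z => ∮ ζ in C(0,1), F ζ z) := by
  refine ⟨circle_cont hc, fun i z hz hzi => ?_⟩
  have h1 : (∮ ζ in C(0,1), F ζ z) = ∮ ζ in C(0,1), (2 * Real.pi * Complex.I)⁻¹ *
      ∮ ξ in C(0,1), F ζ (Function.update z i ξ) / (ξ - z i) :=
    circleIntegral.integral_congr zero_le_one (fun ζ hζ => (hF ζ hζ).2 i z hz hzi)
  simp only
  rw [h1, circleIntegral.integral_const_mul, circle_swap]
  · congr 1
    refine circleIntegral.integral_congr zero_le_one (fun ξ hξ => ?_)
    simp only [div_eq_inv_mul]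
    rw [circleIntegral.integral_const_mul]
  · refine ContinuousOn.div ?_ (by fun_prop) ?_
    · refine hc.comp (f := fun q : ℂ × ℂ => (q.1, Function.update z i q.2)) ?_ ?_
      · exact (by fun_prop : Continuous fun q : ℂ × ℂ => (q.1, Function.update z i q.2)).continuousOn
      · rintro ⟨a, b⟩ ⟨ha, hb⟩
        exact ⟨ha, update_mem hz i (sphere_subset_closedBall hb)⟩
    · rintro ⟨a, b⟩ ⟨ha, hb⟩
      exact sub_ne_of_sphere hb hzi

lemma Cls.of_diff {N : ℕ} {F : (Fin N → ℂ) → ℂ} (hc : ContinuousOn F (closedBall 0 1))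
    (hd : ∀ i, ∀ z ∈ closedBall (0 : Fin N → ℂ) 1, ∀ ξ ∈ ball (0:ℂ) 1,
      DifferentiableAt ℂ (fun w => F (Function.update z i w)) ξ) : Cls N F := by
  refine ⟨hc, fun i z hz hzi => ?_⟩
  have := Complex.circleIntegral_sub_inv_smul_of_differentiable_on_off_countable
    (s := ∅) (by simp) (w := z i) (c := 0) (R := 1) (by simpa using hzi)
    (f := fun w => F (Function.update z i w))
    (hc.comp (by fun_prop) (fun w hw => update_mem hz i hw)) (fun x hx => hd i z hz x hx.1)
  simp only [smul_eq_mul, Function.update_eq_self] at this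
  simp only [div_eq_inv_mul]
  rw [this, ← mul_assoc, inv_mul_cancel₀ Complex.two_pi_I_ne_zero, one_mul]

lemma Cls.const_mul {N : ℕ} {F : (Fin N → ℂ) → ℂ} (hF : Cls N F) (a : ℂ) :
    Cls N (fun z => a * F z) := by
  refine ⟨continuousOn_const.mul hF.1, fun i z hz hzi => ?_⟩
  have := hF.2 i z hz hzi
  simp only [mul_div_assoc]
  rw [circleIntegral.integral_const_mul, this]
  ring

lemma cons_mem {N : ℕ} {r : ℝ} (hr : 0 ≤ r) {a : ℂ} {z : Fin N → ℂ} (ha : ‖a‖ ≤ r)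
    (hz : z ∈ closedBall (0 : Fin N → ℂ) r) :
    (Fin.cons a z : Fin (N+1) → ℂ) ∈ closedBall (0 : Fin (N+1) → ℂ) r := by
  rw [mem_closedBall_zero_iff, pi_norm_le_iff_of_nonneg hr] at *
  intro j
  refine Fin.cases ?_ (fun j => ?_) j
  · simpa using ha
  · simpa using hz j

lemma cls_coeff {N : ℕ} {F : (Fin (N+1) → ℂ) → ℂ} (hF : Cls (N+1) F) (ν : ℕ) :
    Cls N (fun z => ∮ ξ in C(0,1), F (Fin.cons ξ z) / ξ ^ (ν+1)) := by
  refine Cls.integral (F := fun ξ z => F (Fin.cons ξ z) / ξ ^ (ν+1)) ?_ ?_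
  · refine ContinuousOn.div ?_ (by fun_prop) ?_
    · refine hF.1.comp (f := fun q : ℂ × (Fin N → ℂ) => (Fin.cons q.1 q.2 : Fin (N+1) → ℂ)) ?_ ?_
      · exact (by fun_prop : Continuous fun q : ℂ × (Fin N → ℂ) => (Fin.cons q.1 q.2 : Fin (N+1) → ℂ)).continuousOn
      · rintro ⟨a, b⟩ ⟨ha, hb⟩
        exact cons_mem zero_le_one (by simpa using sphere_subset_closedBall ha) hb
    · rintro ⟨a, b⟩ ⟨ha, hb⟩
      have := sub_ne_of_sphere ha (w := 0) (by simp)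
      simpa using this
  · intro ζ hζ
    have hζ1 : ‖ζ‖ ≤ 1 := by simpa using sphere_subset_closedBall hζ
    have : Cls N (fun z => F (Fin.cons ζ z)) := by
      refine ⟨hF.1.comp ?_ ?_, fun i z hz hzi => ?_⟩
      · exact (by fun_prop : Continuous fun q : (Fin N → ℂ) => (Fin.cons ζ q : Fin (N+1) → ℂ)).continuousOn
      · intro z hz; exact cons_mem zero_le_one hζ1 hz
      · have := hF.2 i.succ (Fin.cons ζ z) (cons_mem zero_le_one hζ1 hz) (by simpa using hzi)
        simp only [Fin.cons_update]
        simpa using this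
    have := this.const_mul (ζ ^ (ν+1))⁻¹
    simpa only [div_eq_inv_mul] using this

lemma geom_id {ξ z : ℂ} (hξ : ξ ≠ 0) (h : ξ - z ≠ 0) (m : ℕ) :
    1 / (ξ - z) = (∑ ν ∈ Finset.range m, z ^ ν / ξ ^ (ν+1)) + z ^ m / ξ ^ m / (ξ - z) := by
  induction m with
  | zero => simp
  | succ m ih =>
    rw [Finset.sum_range_succ, ih]
    field_simp
    ring

theorem taylor_width (N : ℕ) : ∃ K : ℝ, 0 ≤ K ∧ ∀ (X : Type) [AddCommGroup X] [Module ℂ X]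
    (F : X → (Fin N → ℂ) → ℂ) (_ : ∀ c, Cls N (F c))
    (_ : ∀ c c', ∀ z ∈ closedBall (0 : Fin N → ℂ) 1, F (c + c') z = F c z + F c' z)
    (_ : ∀ (a : ℂ) c, ∀ z ∈ closedBall (0 : Fin N → ℂ) 1, F (a • c) z = a * F c z) (m : ℕ),
    ∃ Λ : X →ₗ[ℂ] ((Fin N → Fin m) → ℂ), ∀ c, Λ c = 0 → ∀ B : ℝ,
      (∀ z ∈ closedBall (0 : Fin N → ℂ) 1, ‖F c z‖ ≤ B) →
      ∀ z ∈ closedBall (0 : Fin N → ℂ) (1/2), ‖F c z‖ ≤ K * (1/2)^m * B := by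
  induction N with
  | zero =>
    refine ⟨0, le_rfl, fun X _ _ F hF hadd hsmul m => ?_⟩
    refine ⟨{ toFun := fun c _ => F c 0, map_add' := ?_, map_smul' := ?_ }, ?_⟩
    · intro c c'; ext; simp [hadd]
    · intro c c'; ext; simp [hsmul]
    · intro c hc B hB z hz
      have h0 : F c 0 = 0 := congrFun hc (fun i => i.elim0)
      rw [Subsingleton.elim z 0, h0]; simp
  | succ N ih =>
    obtain ⟨K, hK, ih⟩ := ih
    refine ⟨2 * K + 2, by positivity, fun X _ _ F hF hadd hsmul m => ?_⟩
    set G : ℕ → X → (Fin N → ℂ) → ℂ := fun ν c z =>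
      (2 * Real.pi * Complex.I)⁻¹ * ∮ ξ in C(0,1), F c (Fin.cons ξ z) / ξ ^ (ν+1) with hG
    have hGc : ∀ ν c, Cls N (G ν c) := fun ν c => (cls_coeff (hF c) ν).const_mul _
    have hmem : ∀ ξ ∈ sphere (0:ℂ) 1, ∀ z ∈ closedBall (0 : Fin N → ℂ) 1,
        (Fin.cons ξ z : Fin (N+1) → ℂ) ∈ closedBall (0 : Fin (N+1) → ℂ) 1 := fun ξ hξ z hz =>
      cons_mem zero_le_one (by simpa using sphere_subset_closedBall hξ) hz
    have hne : ∀ ξ ∈ sphere (0:ℂ) 1, ξ ≠ 0 := fun ξ hξ => by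
      simpa using sub_ne_of_sphere hξ (w := 0) (by simp)
    have hFcont : ∀ c, ∀ z ∈ closedBall (0 : Fin N → ℂ) 1,
        ContinuousOn (fun ξ => F c (Fin.cons ξ z)) (sphere (0:ℂ) 1) := by
      intro c z hz
      refine (hF c).1.comp ?_ (fun ξ hξ => hmem ξ hξ z hz)
      exact (by fun_prop : Continuous fun ξ : ℂ => (Fin.cons ξ z : Fin (N+1) → ℂ)).continuousOn
    have hintg : ∀ ν c, ∀ z ∈ closedBall (0 : Fin N → ℂ) 1,
        CircleIntegrable (fun ξ => F c (Fin.cons ξ z) / ξ ^ (ν+1)) 0 1 := by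
      intro ν c z hz
      refine ContinuousOn.circleIntegrable zero_le_one ((hFcont c z hz).div (by fun_prop) ?_)
      intro ξ hξ; exact pow_ne_zero _ (hne ξ hξ)
    have hGadd : ∀ ν c c', ∀ z ∈ closedBall (0 : Fin N → ℂ) 1, G ν (c + c') z = G ν c z + G ν c' z := by
      intro ν c c' z hz
      simp only [hG]
      rw [← mul_add, ← circleIntegral.integral_add (hintg ν c z hz) (hintg ν c' z hz)]
      congr 1
      refine circleIntegral.integral_congr zero_le_one fun ξ hξ => ?_
      show F (c + c') (Fin.cons ξ z) / _ = F c (Fin.cons ξ z) / _ + F c' (Fin.cons ξ z) / _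
      rw [hadd c c' _ (hmem ξ hξ z hz), add_div]
    have hGsmul : ∀ ν (a : ℂ) c, ∀ z ∈ closedBall (0 : Fin N → ℂ) 1, G ν (a • c) z = a * G ν c z := by
      intro ν a c z hz
      simp only [hG]
      rw [mul_left_comm, ← circleIntegral.integral_const_mul a]
      congr 1
      refine circleIntegral.integral_congr zero_le_one fun ξ hξ => ?_
      show F (a • c) (Fin.cons ξ z) / _ = a * (F c (Fin.cons ξ z) / _)
      rw [hsmul a c _ (hmem ξ hξ z hz), mul_div_assoc]
    choose Λ hΛ using fun ν => ih X (G ν) (hGc ν) (hGadd ν) (hGsmul ν) m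
    refine ⟨LinearMap.pi fun κ : Fin (N+1) → Fin m =>
      (LinearMap.proj (fun i => κ i.succ)).comp (Λ (κ 0)), ?_⟩
    intro c hc B hB z hz
    have hB0 : 0 ≤ B := (norm_nonneg _).trans (hB 0 (by simp))
    have hΛ0 : ∀ ν < m, Λ ν c = 0 := by
      intro ν hν
      ext κ
      have := congrFun hc (Fin.cons ⟨ν, hν⟩ κ)
      simpa using this
    obtain ⟨z0, z', rfl⟩ : ∃ z0 z', z = (Fin.cons z0 z' : Fin (N+1) → ℂ) :=
      ⟨z 0, Fin.tail z, (Fin.cons_self_tail z).symm⟩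
    rw [mem_closedBall_zero_iff, pi_norm_le_iff_of_nonneg (by norm_num)] at hz
    have hz0 : ‖z0‖ ≤ 1/2 := by simpa using hz 0
    have hz' : z' ∈ closedBall (0 : Fin N → ℂ) (1/2) := by
      rw [mem_closedBall_zero_iff, pi_norm_le_iff_of_nonneg (by norm_num)]
      intro i; simpa using hz i.succ
    have hz'1 : z' ∈ closedBall (0 : Fin N → ℂ) 1 := closedBall_subset_closedBall (by norm_num) hz'
    have hnorm : ∀ ξ ∈ sphere (0:ℂ) 1, ‖ξ‖ = 1 := fun ξ hξ => by simpa using hξ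
    have hGB : ∀ ν, ∀ z ∈ closedBall (0 : Fin N → ℂ) 1, ‖G ν c z‖ ≤ B := by
      intro ν z hz
      have := circleIntegral.norm_two_pi_i_inv_smul_integral_le_of_norm_le_const (c := 0) (R := 1)
        (f := fun ξ => F c (Fin.cons ξ z) / ξ ^ (ν+1)) (C := B) zero_le_one (fun ξ hξ => by
          rw [norm_div, norm_pow, hnorm ξ hξ, one_pow, div_one]
          exact hB _ (hmem ξ hξ z hz))
      simpa [hG] using this
    have hsub : ∀ ξ ∈ sphere (0:ℂ) 1, ξ - z0 ≠ 0 := fun ξ hξ =>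
      sub_ne_of_sphere hξ (by linarith)
    have key : F c (Fin.cons z0 z') = (∑ ν ∈ Finset.range m, z0 ^ ν * G ν c z') +
        (2 * Real.pi * Complex.I)⁻¹ * ∮ ξ in C(0,1),
          F c (Fin.cons ξ z') * (z0 ^ m / ξ ^ m / (ξ - z0)) := by
      have h1 := (hF c).2 0 (Fin.cons z0 z') (cons_mem zero_le_one (by linarith) hz'1)
        (by simp; linarith)
      simp only [Fin.update_cons_zero, Fin.cons_zero] at h1
      rw [h1]
      have h2 : (∮ ξ in C(0,1), F c (Fin.cons ξ z') / (ξ - z0)) =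
          ∮ ξ in C(0,1), ((∑ ν ∈ Finset.range m, z0 ^ ν * (F c (Fin.cons ξ z') / ξ ^ (ν+1))) +
            F c (Fin.cons ξ z') * (z0 ^ m / ξ ^ m / (ξ - z0))) := by
        refine circleIntegral.integral_congr zero_le_one fun ξ hξ => ?_
        show F c (Fin.cons ξ z') / _ = _ + _
        rw [div_eq_mul_one_div, geom_id (hne ξ hξ) (hsub ξ hξ) m, mul_add, Finset.mul_sum]
        congr 1
        refine Finset.sum_congr rfl fun ν _ => by ring
      have hi : ∀ ν ∈ Finset.range m, CircleIntegrable (fun ξ => z0 ^ ν * (F c (Fin.cons ξ z') / ξ ^ (ν+1))) 0 1 :=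
        fun ν _ => (hintg ν c z' hz'1).const_smul (a := z0 ^ ν)
      rw [h2, circleIntegral.integral_add, circleIntegral.integral_fun_sum hi, mul_add, Finset.mul_sum]
      · congr 1
        refine Finset.sum_congr rfl fun ν _ => ?_
        rw [circleIntegral.integral_const_mul]
        simp only [hG]; ring
      · exact CircleIntegrable.fun_sum _ hi
      · refine ContinuousOn.circleIntegrable zero_le_one ((hFcont c z' hz'1).mul ?_)
        refine ContinuousOn.div (ContinuousOn.div (by fun_prop) (by fun_prop) ?_) (by fun_prop) hsub
        intro ξ hξ; exact pow_ne_zero _ (hne ξ hξ)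
    rw [key]
    refine (norm_add_le _ _).trans ?_
    have e1 : ‖∑ ν ∈ Finset.range m, z0 ^ ν * G ν c z'‖ ≤ 2 * (K * (1/2)^m * B) := by
      refine (norm_sum_le _ _).trans ?_
      calc _ ≤ ∑ ν ∈ Finset.range m, (1/2:ℝ)^ν * (K * (1/2)^m * B) := by
            refine Finset.sum_le_sum fun ν hν => ?_
            rw [norm_mul, norm_pow]
            have := hΛ ν c (hΛ0 ν (Finset.mem_range.1 hν)) B (hGB ν) z' hz'
            gcongr
        _ = (∑ ν ∈ Finset.range m, (1/2:ℝ)^ν) * (K * (1/2)^m * B) := by rw [Finset.sum_mul]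
        _ ≤ 2 * (K * (1/2)^m * B) := by
            gcongr
            have := sum_geometric_two_le m
            simpa using this
    have e2 : ‖(2 * Real.pi * Complex.I)⁻¹ * ∮ ξ in C(0,1),
          F c (Fin.cons ξ z') * (z0 ^ m / ξ ^ m / (ξ - z0))‖ ≤ 2 * (1/2)^m * B := by
      have := circleIntegral.norm_two_pi_i_inv_smul_integral_le_of_norm_le_const (c := 0) (R := 1)
        (f := fun ξ => F c (Fin.cons ξ z') * (z0 ^ m / ξ ^ m / (ξ - z0))) (C := 2 * (1/2)^m * B) zero_le_one
        (fun ξ hξ => by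
          have h3 : 1/2 ≤ ‖ξ - z0‖ := by
            have := norm_sub_norm_le ξ z0
            rw [hnorm ξ hξ] at this; linarith
          rw [norm_mul, norm_div, norm_div, norm_pow, norm_pow, hnorm ξ hξ, one_pow, div_one]
          calc _ ≤ B * ((1/2)^m / (1/2)) := by
                gcongr
                exact hB _ (hmem ξ hξ z' hz'1)
            _ = _ := by ring)
      rw [one_mul, smul_eq_mul] at this
      exact this
    calc _ ≤ 2 * (K * (1/2)^m * B) + 2 * (1/2)^m * B := add_le_add e1 e2
      _ = _ := by ring

/-- Polynomial of degree at most `d` in each variable with coefficients `c`. -/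
def mpoly {n d : ℕ} (c : (Fin n → Fin (d+1)) → ℂ) (z : Fin n → ℂ) : ℂ :=
  ∑ a, c a * ∏ i, z i ^ (a i : ℕ)

lemma mpoly_add {n d : ℕ} (c c' : (Fin n → Fin (d+1)) → ℂ) (z : Fin n → ℂ) :
    mpoly (c + c') z = mpoly c z + mpoly c' z := by
  simp [mpoly, add_mul, Finset.sum_add_distrib]

lemma mpoly_smul {n d : ℕ} (t : ℂ) (c : (Fin n → Fin (d+1)) → ℂ) (z : Fin n → ℂ) :
    mpoly (t • c) z = t * mpoly c z := by
  simp [mpoly, Finset.mul_sum, mul_assoc]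

lemma mpoly_diff {n d : ℕ} (c : (Fin n → Fin (d+1)) → ℂ) : Differentiable ℂ (mpoly c) := by
  unfold mpoly; fun_prop

lemma mpoly_bound {n d : ℕ} (c : (Fin n → Fin (d+1)) → ℂ) (z : Fin n → ℂ) {R : ℝ} (hR : 1 ≤ R)
    (hz : ‖z‖ ≤ R) : ‖mpoly c z‖ ≤ (2 * R) ^ (n * d) * ‖c‖ := by
  have hd : d + 1 ≤ 2 ^ d := Nat.lt_two_pow_self
  calc ‖mpoly c z‖ ≤ ∑ a : Fin n → Fin (d+1), ‖c‖ * R ^ (n * d) := by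
        refine (norm_sum_le _ _).trans (Finset.sum_le_sum fun a _ => ?_)
        rw [norm_mul, norm_prod]
        gcongr
        · exact norm_le_pi_norm c a
        · calc _ ≤ ∏ i : Fin n, R ^ d := by
                refine Finset.prod_le_prod (fun i _ => norm_nonneg _) fun i _ => ?_
                rw [norm_pow]
                calc ‖z i‖ ^ (a i : ℕ) ≤ R ^ (a i : ℕ) := by
                      gcongr; exact (norm_le_pi_norm z i).trans hz
                  _ ≤ R ^ d := pow_le_pow_right₀ hR (Nat.lt_succ_iff.1 (a i).2)
            _ = R ^ (n * d) := by simp [← pow_mul, mul_comm]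
    _ = ((d + 1 : ℕ) : ℝ) ^ n * (‖c‖ * R ^ (n * d)) := by simp
    _ ≤ ((2 ^ d : ℕ) : ℝ) ^ n * (‖c‖ * R ^ (n * d)) := by gcongr
    _ = _ := by
        rw [mul_pow, mul_comm n d, pow_mul 2 d n]; push_cast; ring

theorem local_core {N s : ℕ} (hs : 1 ≤ s) (F : (Fin N → ℂ) → ℂ → ℂ)
    (hFc : ContinuousOn (Function.uncurry F) (closedBall (0 : Fin N → ℂ) 1 ×ˢ closedBall (0:ℂ) 2))
    (hFw : ∀ z ∈ closedBall (0 : Fin N → ℂ) 1, DifferentiableOn ℂ (F z) (ball 0 2))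
    (hFz : ∀ ζ ∈ sphere (0:ℂ) 1, ∀ z ∈ closedBall (0 : Fin N → ℂ) 1, ∀ i, ∀ ξ ∈ ball (0:ℂ) 1,
      DifferentiableAt ℂ (fun w => F (Function.update z i w) ζ) ξ)
    (hFs : ∀ z ∈ closedBall (0 : Fin N → ℂ) 1, ∀ w ∈ closedBall (0:ℂ) 2, ‖F z w - w ^ s‖ ≤ 1/4)
    (Φ : (Fin N → ℂ) × ℂ → (Fin (N+1) → ℂ)) (hΦ : Differentiable ℂ Φ)
    (A : ℝ) :
    ∃ d : ℕ, 1 ≤ d ∧ ∃ c : (Fin (N+1) → Fin (d+1)) → ℂ, ‖c‖ = 1 ∧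
      ∀ z ∈ closedBall (0 : Fin N → ℂ) (1/2), ∀ w ∈ closedBall (0:ℂ) 2, F z w = 0 →
        ‖mpoly c (Φ (z, w))‖ ≤ Real.exp (-(A * d)) := by
  obtain ⟨K, hK, htw⟩ := taylor_width N
  obtain ⟨R0, hR0⟩ := ((isCompact_closedBall (0 : Fin N → ℂ) 1).prod
    (isCompact_sphere (0:ℂ) 1)).exists_bound_of_continuousOn hΦ.continuous.continuousOn
  set R := max R0 1
  have hR1 : 1 ≤ R := le_max_right _ _
  have hR : ∀ z ∈ closedBall (0 : Fin N → ℂ) 1, ∀ w ∈ sphere (0:ℂ) 1, ‖Φ (z, w)‖ ≤ R :=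
    fun z hz w hw => (hR0 (z, w) ⟨hz, hw⟩).trans (le_max_left _ _)
  set C : ℝ := 2 * (2 ^ s + 1) * (K * (2 * Real.pi * (4/3))) with hC
  have hC0 : 0 ≤ C := by positivity
  obtain ⟨l, hl⟩ := exists_nat_ge ((((N+1 : ℕ) : ℝ) * Real.log (2 * R) + |A| + Real.log (C + 1)) / Real.log 2)
  set l' := l + 1 with hl'
  set k := (s+1) * l' with hk
  have hkpos : 1 ≤ k := Nat.mul_pos (by omega) (by omega)
  set d := (s+1) * k ^ N - 1 with hd
  set m := k ^ (N+1) with hm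
  have hkN : 1 ≤ k ^ N := Nat.one_le_pow _ _ hkpos
  have hd1 : d + 1 = (s+1) * k ^ N := by
    have : 1 ≤ (s+1) * k ^ N := Nat.mul_pos (by omega) (by omega)
    omega
  have hdge : 1 ≤ d := by
    have : 2 * 1 ≤ (s+1) * k ^ N := Nat.mul_le_mul (by omega) hkN
    omega
  have hld : l' * d ≤ m := by
    calc l' * d ≤ l' * (d + 1) := Nat.mul_le_mul_left _ (by omega)
      _ = m := by rw [hd1, hm, pow_succ]; simp only [hk]; ring
  have hdim : s * m ^ N < (d + 1) ^ (N + 1) := by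
    rw [hd1, hm, mul_pow (s+1) (k^N), ← pow_mul, ← pow_mul, mul_comm (N+1) N]
    refine Nat.mul_lt_mul_of_pos_right ?_ (Nat.pow_pos hkpos)
    calc s < s + 1 := by omega
      _ ≤ (s+1)^(N+1) := Nat.le_self_pow (by omega) _
  -- the moments
  let X := (Fin (N+1) → Fin (d+1)) → ℂ
  set M : ℕ → X → (Fin N → ℂ) → ℂ := fun j c z =>
    ∮ ζ in C(0,1), mpoly c (Φ (z, ζ)) * ζ ^ j / F z ζ with hM
  have hsub : ∀ ζ ∈ sphere (0:ℂ) 1, ζ ∈ closedBall (0:ℂ) 2 := fun ζ hζ => by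
    have : ‖ζ‖ = 1 := by simpa using hζ
    simp [this]
  have hFlow : ∀ z ∈ closedBall (0 : Fin N → ℂ) 1, ∀ ζ ∈ sphere (0:ℂ) 1, 3/4 ≤ ‖F z ζ‖ := by
    intro z hz ζ hζ
    have h1 := hFs z hz ζ (hsub ζ hζ)
    have h2 : ‖ζ ^ s‖ = 1 := by rw [norm_pow]; have : ‖ζ‖ = 1 := by simpa using hζ
                                simp [this]
    have h3 := norm_sub_norm_le (ζ ^ s) (F z ζ)
    rw [norm_sub_rev, h2] at h3
    linarith
  have hFne : ∀ z ∈ closedBall (0 : Fin N → ℂ) 1, ∀ ζ ∈ sphere (0:ℂ) 1, F z ζ ≠ 0 := by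
    intro z hz ζ hζ h
    have := hFlow z hz ζ hζ
    rw [h, norm_zero] at this; linarith
  have hjc : ∀ (j : ℕ) (c : X), ContinuousOn (Function.uncurry fun (ζ : ℂ) (z : Fin N → ℂ) =>
      mpoly c (Φ (z, ζ)) * ζ ^ j / F z ζ) (sphere (0:ℂ) 1 ×ˢ closedBall (0 : Fin N → ℂ) 1) := by
    intro j c
    refine ContinuousOn.div ?_ ?_ ?_
    · have h1 := (mpoly_diff (n := N+1) (d := d) c).continuous
      have h2 := hΦ.continuous
      exact (by fun_prop : Continuous fun q : ℂ × (Fin N → ℂ) => mpoly c (Φ (q.2, q.1)) * q.1 ^ j).continuousOn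
    · refine hFc.comp (f := fun q : ℂ × (Fin N → ℂ) => (q.2, q.1)) (by fun_prop) ?_
      rintro ⟨a, b⟩ ⟨ha, hb⟩
      exact ⟨hb, hsub _ ha⟩
    · rintro ⟨a, b⟩ ⟨ha, hb⟩
      exact hFne _ hb _ ha
  have hjz : ∀ (j : ℕ) (c : X), ∀ z ∈ closedBall (0 : Fin N → ℂ) 1,
      CircleIntegrable (fun ζ => mpoly c (Φ (z, ζ)) * ζ ^ j / F z ζ) 0 1 := by
    intro j c z hz
    refine ContinuousOn.circleIntegrable zero_le_one ?_
    exact (hjc j c).comp (f := fun ζ : ℂ => (ζ, z)) (by fun_prop) (fun ζ hζ => ⟨hζ, hz⟩)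
  have hMcls : ∀ j c, Cls N (M j c) := by
    intro j c
    refine Cls.integral (hjc j c) fun ζ hζ => Cls.of_diff ?_ ?_
    · exact (hjc j c).comp (f := fun z : Fin N → ℂ => (ζ, z)) (by fun_prop) (fun z hz => ⟨hζ, hz⟩)
    · intro i z hz ξ hξ
      refine DifferentiableAt.div ?_ (hFz ζ hζ z hz i ξ hξ) ?_
      · have h1 := mpoly_diff (n := N+1) (d := d) c
        have h3 : Differentiable ℂ (fun w : ℂ => Function.update z i w) := by
          rw [differentiable_pi]
          intro i'
          by_cases h : i' = i
          · subst h; simp only [Function.update_self]; fun_prop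
          · simp only [Function.update_of_ne h]; fun_prop
        have : Differentiable ℂ (fun w => mpoly c (Φ (Function.update z i w, ζ)) * ζ ^ j) := by
          fun_prop
        exact this ξ
      · exact hFne _ (update_mem hz i (ball_subset_closedBall hξ)) _ hζ
  have hMadd : ∀ j c c', ∀ z ∈ closedBall (0 : Fin N → ℂ) 1, M j (c + c') z = M j c z + M j c' z := by
    intro j c c' z hz
    simp only [hM]
    rw [← circleIntegral.integral_add (hjz j c z hz) (hjz j c' z hz)]
    refine circleIntegral.integral_congr zero_le_one fun ζ hζ => ?_
    show mpoly (c + c') _ * _ / _ = mpoly c _ * _ / _ + mpoly c' _ * _ / _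
    rw [mpoly_add]; ring
  have hMsmul : ∀ j (a : ℂ) c, ∀ z ∈ closedBall (0 : Fin N → ℂ) 1, M j (a • c) z = a * M j c z := by
    intro j a c z hz
    simp only [hM]
    rw [← circleIntegral.integral_const_mul a]
    refine circleIntegral.integral_congr zero_le_one fun ζ hζ => ?_
    show mpoly (a • c) _ * _ / _ = a * (mpoly c _ * _ / _)
    rw [mpoly_smul]; ring
  choose Λ hΛ using fun j => htw X (M j) (hMcls j) (hMadd j) (hMsmul j) m
  let T : X →ₗ[ℂ] (Fin s → (Fin N → Fin m) → ℂ) := LinearMap.pi fun j => Λ j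
  have hker : LinearMap.ker T ≠ ⊥ := by
    refine LinearMap.ker_ne_bot_of_finrank_lt ?_
    simp only [X, Module.finrank_pi, Module.finrank_pi_fintype, Finset.sum_const, Finset.card_univ,
      Fintype.card_pi, Fintype.card_fin, Finset.prod_const, smul_eq_mul]
    exact hdim
  obtain ⟨c0, hc0, hc0ne⟩ := (Submodule.ne_bot_iff _).1 hker
  have hn0 : ‖c0‖ ≠ 0 := norm_ne_zero_iff.2 hc0ne
  refine ⟨d, hdge, ((‖c0‖⁻¹ : ℝ) : ℂ) • c0, ?_, ?_⟩
  · rw [norm_smul, Complex.norm_real, norm_inv, norm_norm, inv_mul_cancel₀ hn0]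
  set c : X := ((‖c0‖⁻¹ : ℝ) : ℂ) • c0 with hc
  have hcn : ‖c‖ = 1 := by
    rw [hc, norm_smul, Complex.norm_real, norm_inv, norm_norm, inv_mul_cancel₀ hn0]
  have hTc : ∀ j < s, Λ j c = 0 := by
    intro j hj
    have h1 : T c = 0 := by
      rw [hc, map_smul, LinearMap.mem_ker.1 hc0, smul_zero]
    exact congrFun h1 ⟨j, hj⟩
  intro z hz w hw hzero
  have hz1 : z ∈ closedBall (0 : Fin N → ℂ) 1 := closedBall_subset_closedBall (by norm_num) hz
  set B : ℝ := 2 * Real.pi * (4/3) * (2 * R) ^ ((N+1) * d) with hB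
  have hMB : ∀ j, ∀ z ∈ closedBall (0 : Fin N → ℂ) 1, ‖M j c z‖ ≤ B := by
    intro j z hz
    have := circleIntegral.norm_integral_le_of_norm_le_const (c := 0) (R := 1)
      (f := fun ζ => mpoly c (Φ (z, ζ)) * ζ ^ j / F z ζ) (C := 4/3 * (2 * R) ^ ((N+1) * d)) zero_le_one
      (fun ζ hζ => by
        have h1 : ‖ζ‖ = 1 := by simpa using hζ
        rw [norm_div, norm_mul, norm_pow, h1, one_pow, mul_one]
        have h2 := mpoly_bound c _ hR1 (hR z hz ζ hζ)
        rw [hcn, mul_one] at h2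
        calc _ ≤ (2 * R) ^ ((N+1) * d) / (3/4) := by
              have := hFlow z hz ζ hζ
              gcongr
          _ = _ := by ring)
    refine this.trans (le_of_eq ?_)
    rw [hB]; ring
  have hev := eval_bound hs (F := F z) (P := fun w => mpoly c (Φ (z, w))) (w0 := w)
    (S := K * (1/2)^m * B) ⟨hFw z hz1, ?_⟩ (hFs z hz1) ?_ hw hzero ?_
  · refine hev.trans ?_
    have e1 : 2 * (2 ^ s + 1) * (K * (1 / 2) ^ m * B) = C * (2 * R) ^ ((N+1) * d) * (1/2)^m := by
      rw [hC, hB]; ring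
    rw [e1]
    have hlog2 : 0 < Real.log 2 := Real.log_pos (by norm_num)
    have h2R : 0 < 2 * R := by linarith
    have e2 : (2 * R) ^ ((N+1) * d) = Real.exp (((N+1 : ℕ) : ℝ) * d * Real.log (2 * R)) := by
      rw [← Real.rpow_natCast, Real.rpow_def_of_pos h2R]; congr 1; push_cast; ring
    have e3 : ((1:ℝ)/2)^m = Real.exp (- (m * Real.log 2)) := by
      rw [← Real.rpow_natCast, Real.rpow_def_of_pos (by norm_num)]; congr 1
      rw [one_div, Real.log_inv]; ring
    have e4 : C ≤ Real.exp (Real.log (C + 1)) := by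
      rw [Real.exp_log (by linarith)]; linarith
    rw [e2, e3]
    calc _ ≤ Real.exp (Real.log (C + 1)) * Real.exp (((N+1 : ℕ) : ℝ) * d * Real.log (2 * R)) *
          Real.exp (- (m * Real.log 2)) := by gcongr
      _ = Real.exp (Real.log (C + 1) + ((N+1 : ℕ) : ℝ) * d * Real.log (2 * R) - m * Real.log 2) := by
          rw [← Real.exp_add, ← Real.exp_add, sub_eq_add_neg]
      _ ≤ _ := by
          refine Real.exp_le_exp.2 ?_
          rw [div_le_iff₀ hlog2] at hl
          have hd1' : (1:ℝ) ≤ d := by exact_mod_cast hdge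
          have hm' : (l' : ℝ) * d ≤ m := by exact_mod_cast hld
          have hll : (l : ℝ) ≤ l' := by rw [hl']; push_cast; linarith
          have hlogC : 0 ≤ Real.log (C + 1) := Real.log_nonneg (by linarith)
          have f1 : (m : ℝ) * Real.log 2 ≥ d * (((N+1 : ℕ) : ℝ) * Real.log (2 * R) + |A| + Real.log (C + 1)) := by
            calc (m : ℝ) * Real.log 2 ≥ (l' * d) * Real.log 2 := by gcongr
              _ ≥ (l * d) * Real.log 2 := by gcongr
              _ = d * (l * Real.log 2) := by ring
              _ ≥ _ := by gcongr
          have f2 : A * d ≤ |A| * d := by gcongr; exact le_abs_self A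
          nlinarith
  · rw [closure_ball _ (by norm_num)]
    exact hFc.comp (f := fun w : ℂ => (z, w)) (by fun_prop) (fun w hw => ⟨hz1, hw⟩)
  · have h1 := mpoly_diff (n := N+1) (d := d) c
    fun_prop
  · intro j hj
    exact hΛ j c (hTc j hj) B (hMB j) z hz

/-- Linear embedding with i-th coordinate zero. -/
def insE {N : ℕ} (i : Fin (N+1)) : (Fin N → ℂ) →L[ℂ] (Fin (N+1) → ℂ) :=
  ContinuousLinearMap.pi (fun j => Fin.insertNth (α := fun _ => (Fin N → ℂ) →L[ℂ] ℂ) i 0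
    (fun k => ContinuousLinearMap.proj k) j)

lemma insE_same {N : ℕ} (i : Fin (N+1)) (z : Fin N → ℂ) : insE i z i = 0 := by
  simp [insE]

lemma insE_succAbove {N : ℕ} (i : Fin (N+1)) (z : Fin N → ℂ) (k : Fin N) :
    insE i z (i.succAbove k) = z k := by
  simp [insE]

lemma update_affine {N : ℕ} (z : Fin N → ℂ) (j : Fin N) (w : ℂ) :
    Function.update z j w = Function.update z j 0 + w • (Pi.single j 1 : Fin N → ℂ) := by
  ext k
  by_cases h : k = j
  · subst h; simp
  · simp [h]

theorem local_geom {N : ℕ} {D : Set (Fin (N+1) → ℂ)} (hD : IsOpen D) {ψ : (Fin (N+1) → ℂ) → ℂ}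
    (hψ : ContinuousOn ψ D)
    (hline : ∀ a b : Fin (N+1) → ℂ, ∀ t : ℂ, a + t • b ∈ D →
      DifferentiableAt ℂ (fun t : ℂ => ψ (a + t • b)) t)
    {p : Fin (N+1) → ℂ} (hp : p ∈ D) (hp0 : ψ p = 0)
    (hnz : ∀ r > 0, ∃ x ∈ ball p r, ψ x ≠ 0) :
    ∃ U : Set (Fin (N+1) → ℂ), IsOpen U ∧ p ∈ U ∧ ∀ A : ℝ,
      ∃ d : ℕ, 1 ≤ d ∧ ∃ c : (Fin (N+1) → Fin (d+1)) → ℂ, ‖c‖ = 1 ∧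
        ∀ z ∈ U, ψ z = 0 → ‖mpoly c z‖ ≤ Real.exp (-(A * d)) := by
  obtain ⟨r, hr, hrD⟩ := Metric.isOpen_iff.1 hD p hp
  obtain ⟨x, hx, hxne⟩ := hnz r hr
  set b := x - p with hb
  have hbr : ‖b‖ < r := by rw [hb, ← dist_eq_norm]; exact hx
  have hbne : b ≠ 0 := by
    intro h
    have : x = p := sub_eq_zero.1 h
    exact hxne (this ▸ hp0)
  have hbpos : 0 < ‖b‖ := norm_pos_iff.2 hbne
  obtain ⟨i, hi⟩ : ∃ i, b i ≠ 0 := Function.ne_iff.1 hbne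
  set g : ℂ → ℂ := fun t => ψ (p + t • b) with hg
  set ρ := r / ‖b‖ with hρ
  have hρ1 : 1 < ρ := (one_lt_div hbpos).2 hbr
  have hgd : DifferentiableOn ℂ g (ball 0 ρ) := by
    intro t ht
    refine (hline p b t (hrD ?_)).differentiableWithinAt
    rw [mem_ball, dist_eq_norm, add_sub_cancel_left, norm_smul]
    have : ‖t‖ < ρ := by simpa using ht
    rwa [hρ, lt_div_iff₀ hbpos] at this
  have hgan : AnalyticOnNhd ℂ g (ball 0 ρ) := hgd.analyticOnNhd isOpen_ball
  have hg0 : AnalyticAt ℂ g 0 := hgan 0 (by simp; linarith)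
  have hnev : ¬ ∀ᶠ z in nhds 0, g z = 0 := by
    intro h
    have := hgan.eqOn_zero_of_preconnected_of_eventuallyEq_zero
      (convex_ball _ _).isPreconnected (by simp; linarith : (0:ℂ) ∈ ball 0 ρ) h
    have h1 := this (by simpa using hρ1 : (1:ℂ) ∈ ball 0 ρ)
    apply hxne
    simpa [hg, hb] using h1
  obtain ⟨s, e, hean, he0, hev⟩ := hg0.exists_eventuallyEq_pow_smul_nonzero_iff.2 hnev
  have hs : 1 ≤ s := by
    by_contra h
    have hs0 : s = 0 := by omega
    have := hev.self_of_nhds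
    simp [hs0, hg, hp0] at this
    exact he0 this.symm
  -- choose δ
  have hev2 : ∀ᶠ z in nhds (0:ℂ), (AnalyticAt ℂ e z ∧ e z ≠ 0 ∧ g z = z ^ s * e z) ∧ ‖z‖ * ‖b‖ < r/2 := by
    refine ((hean.eventually_analyticAt).and ((hean.continuousAt.eventually_ne he0).and ?_)).and ?_
    · filter_upwards [hev] with z hz
      simpa using hz
    · have : Continuous fun z : ℂ => ‖z‖ * ‖b‖ := by fun_prop
      exact this.continuousAt.eventually_lt continuousAt_const (by simpa using half_pos hr)
  obtain ⟨δ0, hδ0, hδ⟩ := Metric.eventually_nhds_iff_ball.1 hev2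
  set δ := δ0 / 3 with hδdef
  have hδpos : 0 < δ := by positivity
  have hin : ∀ w ∈ closedBall (0:ℂ) 2, (δ : ℂ) * w ∈ ball (0:ℂ) δ0 := by
    intro w hw
    have : ‖w‖ ≤ 2 := by simpa using hw
    rw [mem_ball_zero_iff, norm_mul, Complex.norm_real, Real.norm_eq_abs, abs_of_pos hδpos]
    calc δ * ‖w‖ ≤ δ * 2 := by gcongr
      _ < δ0 := by rw [hδdef]; linarith
  have hδne : (δ:ℂ) ≠ 0 := by exact_mod_cast hδpos.ne'
  set E := insE i with hE
  -- bound for E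
  obtain ⟨η0, hη0, hEη⟩ : ∃ η0 > 0, ∀ z ∈ closedBall (0 : Fin N → ℂ) η0, ‖E z‖ < r/2 := by
    have : ∀ᶠ z in nhds (0 : Fin N → ℂ), ‖E z‖ < r/2 := by
      have hc : Continuous fun z => ‖E z‖ := by fun_prop
      exact hc.continuousAt.eventually_lt continuousAt_const (by simpa using half_pos hr)
    obtain ⟨η, hη, h⟩ := Metric.eventually_nhds_iff_ball.1 this
    exact ⟨η/2, by positivity, fun z hz => h z (closedBall_subset_ball (by linarith) hz)⟩
  set Ψ : (Fin N → ℂ) × ℂ → (Fin (N+1) → ℂ) := fun q => p + E q.1 + ((δ:ℂ) * q.2) • b with hΨ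
  have hΨD : ∀ z ∈ closedBall (0 : Fin N → ℂ) η0, ∀ w ∈ closedBall (0:ℂ) 2, Ψ (z, w) ∈ D := by
    intro z hz w hw
    refine hrD ?_
    rw [mem_ball, dist_eq_norm]
    have h1 := hEη z hz
    have h2 := (hδ _ (hin w hw)).2
    calc _ = ‖E z + ((δ:ℂ) * w) • b‖ := by simp only [hΨ]; congr 1; abel
      _ ≤ ‖E z‖ + ‖(δ:ℂ) * w‖ * ‖b‖ := by
          refine (norm_add_le _ _).trans ?_
          rw [norm_smul]
      _ < r := by linarith
  have hΨc : Continuous Ψ := by simp only [hΨ]; fun_prop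
  set H : (Fin N → ℂ) → ℂ → ℂ := fun z w => ψ (Ψ (z, w)) / (e (δ * w) * δ ^ s) with hH
  have hden : ∀ w ∈ closedBall (0:ℂ) 2, e (δ * w) * δ ^ s ≠ 0 := fun w hw =>
    mul_ne_zero (hδ _ (hin w hw)).1.2.1 (pow_ne_zero _ hδne)
  have hHc : ContinuousOn (Function.uncurry H) (closedBall (0 : Fin N → ℂ) η0 ×ˢ closedBall (0:ℂ) 2) := by
    refine ContinuousOn.div ?_ ?_ ?_
    · exact hψ.comp (f := Ψ) hΨc.continuousOn (fun q hq => hΨD _ hq.1 _ hq.2)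
    · refine ContinuousOn.mul ?_ continuousOn_const
      have hec : ContinuousOn e (ball 0 δ0) := fun z hz => (hδ z hz).1.1.continuousAt.continuousWithinAt
      exact hec.comp (f := fun q : (Fin N → ℂ) × ℂ => (δ:ℂ) * q.2) (by fun_prop) (fun q hq => hin _ hq.2)
    · exact fun q hq => hden _ hq.2
  have hH0 : ∀ w ∈ closedBall (0:ℂ) 2, H 0 w = w ^ s := by
    intro w hw
    have h1 := (hδ _ (hin w hw)).1.2.2
    simp only [hH, hΨ, map_zero, add_zero]
    rw [show ψ (p + ((δ:ℂ) * w) • b) = (δ * w) ^ s * e (δ * w) from h1, div_eq_iff (hden w hw)]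
    ring
  have huc := ((isCompact_closedBall (0 : Fin N → ℂ) η0).prod
    (isCompact_closedBall (0:ℂ) 2)).uniformContinuousOn_of_continuous hHc
  obtain ⟨η1, hη1, hη1'⟩ := Metric.uniformContinuousOn_iff.1 huc (1/4) (by norm_num)
  set η := min η0 (η1 / 2) with hη
  have hηpos : 0 < η := by positivity
  have hηne : (η:ℂ) ≠ 0 := by exact_mod_cast hηpos.ne'
  have hsm : ∀ z ∈ closedBall (0 : Fin N → ℂ) 1, (η:ℂ) • z ∈ closedBall (0 : Fin N → ℂ) η := by
    intro z hz
    have : ‖z‖ ≤ 1 := by simpa using hz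
    rw [mem_closedBall_zero_iff, norm_smul, Complex.norm_real, Real.norm_eq_abs, abs_of_pos hηpos]
    nlinarith
  have hsm0 : ∀ z ∈ closedBall (0 : Fin N → ℂ) 1, (η:ℂ) • z ∈ closedBall (0 : Fin N → ℂ) η0 :=
    fun z hz => closedBall_subset_closedBall (min_le_left _ _) (hsm z hz)
  have hline2 : ∀ a v : Fin (N+1) → ℂ, ∀ (Q : ℂ → Fin (N+1) → ℂ), (∀ t, Q t = a + t • v) →
      ∀ t, Q t ∈ D → DifferentiableAt ℂ (fun t => ψ (Q t)) t := by
    intro a v Q hQ t ht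
    have : Q = fun t => a + t • v := funext hQ
    subst this
    exact hline a v t ht
  have hcore := local_core hs (fun z w => H ((η:ℂ) • z) w) ?_ ?_ ?_ ?_
    (fun q => Ψ ((η:ℂ) • q.1, q.2)) (by simp only [hΨ]; fun_prop)
  · -- the neighbourhood
    set W : (Fin (N+1) → ℂ) → ℂ := fun x => (x i - p i) / (δ * b i) with hW
    set Z : (Fin (N+1) → ℂ) → (Fin N → ℂ) := fun x k =>
      (x (i.succAbove k) - p (i.succAbove k) - δ * W x * b (i.succAbove k)) / η with hZ
    have hWc : Continuous W := by simp only [hW]; fun_prop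
    have hZc : Continuous Z := by simp only [hZ]; fun_prop
    have hinv : ∀ x, Ψ ((η:ℂ) • Z x, W x) = x := by
      intro x
      ext j
      simp only [hΨ, Pi.add_apply, Pi.smul_apply, smul_eq_mul]
      rcases Fin.eq_self_or_eq_succAbove i j with rfl | ⟨k, rfl⟩
      · rw [hE, insE_same]
        simp only [hW]; field_simp; ring
      · rw [hE, insE_succAbove]
        simp only [Pi.smul_apply, smul_eq_mul, hZ]; field_simp; ring
    refine ⟨{x | ‖Z x‖ < 1/2 ∧ ‖W x‖ < 2}, ?_, ?_, ?_⟩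
    · exact (isOpen_lt hZc.norm continuous_const).inter (isOpen_lt hWc.norm continuous_const)
    · have hW0 : W p = 0 := by simp [hW]
      have hZ0 : Z p = 0 := by ext k; simp [hZ, hW0]
      simp [hW0, hZ0]
    · intro A
      obtain ⟨d, hd, c, hc, hcA⟩ := hcore A
      refine ⟨d, hd, c, hc, fun x hx hψx => ?_⟩
      have := hcA (Z x) (by simpa using hx.1.le) (W x) (by simpa using hx.2.le) (by
        simp only [hH, hinv, hψx, zero_div])
      simpa only [hinv] using this
  · refine hHc.comp (f := fun q : (Fin N → ℂ) × ℂ => ((η:ℂ) • q.1, q.2)) (by fun_prop) ?_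
    exact fun q hq => ⟨hsm0 _ hq.1, hq.2⟩
  · intro z hz w hw
    have hw' := ball_subset_closedBall hw
    refine DifferentiableAt.differentiableWithinAt ?_
    refine DifferentiableAt.div ?_ ?_ (hden w hw')
    · refine hline2 (p + E ((η:ℂ) • z)) ((δ:ℂ) • b) (fun w => Ψ ((η:ℂ) • z, w)) ?_ w
        (hΨD _ (hsm0 z hz) _ hw')
      intro t; simp only [hΨ, smul_smul, mul_comm]
    · have h1 := (hδ _ (hin w hw')).1.1.differentiableAt
      have h2 : DifferentiableAt ℂ (fun w : ℂ => e (δ * w)) w :=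
        h1.comp w (by fun_prop : DifferentiableAt ℂ (fun w : ℂ => (δ:ℂ) * w) w)
      exact h2.mul_const _
  · intro ζ hζ z hz j ξ hξ
    have hζ' : ζ ∈ closedBall (0:ℂ) 2 := by
      have : ‖ζ‖ = 1 := by simpa using hζ
      simp [this]
    refine DifferentiableAt.div_const ?_ _
    refine hline2 (p + E ((η:ℂ) • Function.update z j 0) + ((δ:ℂ) * ζ) • b)
      ((η:ℂ) • E (Pi.single j 1)) (fun w => Ψ ((η:ℂ) • Function.update z j w, ζ)) ?_ ξ
        (hΨD _ (hsm0 _ (update_mem hz j (ball_subset_closedBall hξ))) _ hζ')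
    intro t
    simp only [hΨ]
    rw [update_affine z j t, smul_add, map_add, map_smul, map_smul, map_smul, smul_comm t]
    abel
  · intro z hz w hw
    rw [← hH0 w hw, ← dist_eq_norm]
    refine (hη1' ((η:ℂ) • z, w) ⟨hsm0 z hz, hw⟩ (0, w) ⟨by simp [hη0.le], hw⟩ ?_).le
    rw [Prod.dist_eq]
    have : ‖(η:ℂ) • z‖ ≤ η := by simpa using hsm z hz
    have h2 : η ≤ η1 / 2 := min_le_right _ _
    simp only [dist_zero_right, dist_self]
    exact max_lt (by linarith) hη1

lemma ae_choice {α : Type*} [MeasurableSpace α] {μ : MeasureTheory.Measure α}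
    (h : ℕ → α → ℝ) (hi : ∀ k, MeasureTheory.Integrable (h k) μ) (h0 : ∀ k x, 0 ≤ h k x) {C : ℝ}
    (hC : ∀ k, ∫ x, h k x ∂μ ≤ C) :
    ∀ᵐ x ∂μ, ∃ T : ℝ, 0 ≤ T ∧ ∀ k, h k x ≤ T * 2 ^ k := by
  have hmeas : ∀ k, AEMeasurable (fun x => ENNReal.ofReal (h k x * (1/2)^k)) μ := fun k =>
    ((hi k).aemeasurable.mul_const _).ennreal_ofReal
  have h1 : ∫⁻ x, ∑' k, ENNReal.ofReal (h k x * (1/2)^k) ∂μ ≠ ⊤ := by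
    rw [MeasureTheory.lintegral_tsum hmeas]
    have h2 : ∀ k, ∫⁻ x, ENNReal.ofReal (h k x * (1/2)^k) ∂μ ≤ ENNReal.ofReal (|C| * (1/2)^k) := by
      intro k
      rw [← MeasureTheory.ofReal_integral_eq_lintegral_ofReal ((hi k).mul_const _)
        (Filter.Eventually.of_forall fun x => mul_nonneg (h0 k x) (by positivity))]
      refine ENNReal.ofReal_le_ofReal ?_
      rw [MeasureTheory.integral_mul_const]
      have := (hC k).trans (le_abs_self C)
      gcongr
    refine ne_top_of_le_ne_top ?_ (ENNReal.tsum_le_tsum h2)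
    rw [← ENNReal.ofReal_tsum_of_nonneg (fun k => by positivity)
      (summable_geometric_two.mul_left _)]
    exact ENNReal.ofReal_ne_top
  have hm : AEMeasurable (fun x => ∑' k, ENNReal.ofReal (h k x * (1/2)^k)) μ :=
    AEMeasurable.tsum hmeas
  filter_upwards [MeasureTheory.ae_lt_top' hm h1] with x hx
  refine ⟨(∑' k, ENNReal.ofReal (h k x * (1/2)^k)).toReal, ENNReal.toReal_nonneg, fun k => ?_⟩
  have h3 := ENNReal.le_tsum (f := fun k => ENNReal.ofReal (h k x * (1/2)^k)) k
  have h4 := (ENNReal.ofReal_le_iff_le_toReal hx.ne).1 h3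
  calc h k x = (h k x * (1/2)^k) * 2^k := by
        rw [mul_assoc, ← mul_pow]; norm_num
    _ ≤ _ := by gcongr

lemma circle_choice (d : ℕ → ℕ) (hd : ∀ k, 1 ≤ d k) (q : ℕ → ℂ[X]) (hq : ∀ k, (q k).natDegree ≤ d k)
    {T0 ρ : ℝ} (hT0 : 0 ≤ T0) (hρ : 1 ≤ ρ)
    (hup : ∀ k j, ‖(q k).coeff j‖ ≤ Real.exp (T0 * ρ ^ k * d k))
    (hlo : ∀ k, ∃ j, Real.exp (-(T0 * ρ ^ k * d k)) ≤ ‖(q k).coeff j‖) :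
    ∃ x : ℂ, ‖x‖ = 1 ∧ ∃ T : ℝ, 0 ≤ T ∧
      ∀ k, Real.exp (-(T * (2 * ρ) ^ k * d k)) ≤ ‖(q k).eval x‖ := by
  set W : ℕ → ℝ := fun k => (T0 + 1) * ρ ^ k * d k with hW
  have hd' : ∀ k, (1:ℝ) ≤ d k := fun k => by exact_mod_cast hd k
  have hρk : ∀ k, 1 ≤ ρ ^ k := fun k => one_le_pow₀ hρ
  have hWpos : ∀ k, 0 < W k := fun k => by
    have := hd' k; have := hρk k
    simp only [hW]; positivity
  have h2d : ∀ k, (2:ℝ) ^ (d k) ≤ Real.exp (d k) := by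
    intro k
    rw [← Real.exp_one_pow]
    gcongr
    have := Real.add_one_le_exp 1; linarith
  have hWge : ∀ k, T0 * ρ ^ k * d k + d k ≤ W k := by
    intro k
    simp only [hW]
    have := hd' k; have := hρk k
    nlinarith
  have hne : ∀ k, q k ≠ 0 := by
    intro k h
    obtain ⟨j, hj⟩ := hlo k
    rw [h] at hj
    simp at hj
    exact absurd hj (not_le.2 (Real.exp_pos _))
  set u : ℕ → ℝ → ℝ := fun k θ => Real.log ‖(q k).eval (circleMap 0 1 θ)‖ with hu
  have hupper : ∀ k θ, u k θ ≤ W k := by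
    intro k θ
    have hb : ‖(q k).eval (circleMap 0 1 θ)‖ ≤ Real.exp (W k) := by
      rw [eval_eq_sum_range]
      refine (norm_sum_le _ _).trans ?_
      calc _ ≤ ∑ j ∈ Finset.range ((q k).natDegree + 1), Real.exp (T0 * ρ ^ k * d k) := by
            refine Finset.sum_le_sum fun j _ => ?_
            rw [norm_mul, norm_pow, norm_circleMap_zero]
            simpa using hup k j
        _ = (((q k).natDegree + 1 : ℕ) : ℝ) * Real.exp (T0 * ρ ^ k * d k) := by simp
        _ ≤ ((2 ^ (d k) : ℕ) : ℝ) * Real.exp (T0 * ρ ^ k * d k) := by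
            gcongr
            exact (Nat.succ_le_succ (hq k)).trans Nat.lt_two_pow_self
        _ ≤ Real.exp (d k) * Real.exp (T0 * ρ ^ k * d k) := by
            gcongr
            push_cast; exact h2d k
        _ ≤ _ := by
            rw [← Real.exp_add]
            exact Real.exp_le_exp.2 (by linarith [hWge k])
    rcases eq_or_lt_of_le (norm_nonneg ((q k).eval (circleMap 0 1 θ))) with h | h
    · simp only [hu, ← h, Real.log_zero]; exact (hWpos k).le
    · exact (Real.log_le_iff_le_exp h).2 hb
  have hpi : 0 < 2 * Real.pi := by positivity
  have hintg : ∀ k, IntervalIntegrable (u k) MeasureTheory.volume 0 (2 * Real.pi) := fun k =>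
    (q k).intervalIntegrable_mahlerMeasure
  have hlower : ∀ k, -(2 * Real.pi * W k) ≤ ∫ θ in (0)..(2 * Real.pi), u k θ := by
    intro k
    obtain ⟨j, hj⟩ := hlo k
    have h1 := (q k).norm_coeff_le_choose_mul_mahlerMeasure j
    rw [mahlerMeasure_def_of_ne_zero (hne k)] at h1
    have h2 : (((q k).natDegree.choose j : ℕ) : ℝ) ≤ Real.exp (d k) := by
      refine le_trans ?_ (h2d k)
      have := (Nat.choose_le_two_pow (q k).natDegree j).trans (Nat.pow_le_pow_right (by norm_num) (hq k))
      exact_mod_cast this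
    have h3 : Real.exp (-(T0 * ρ ^ k * d k)) ≤ Real.exp (d k + (2 * Real.pi)⁻¹ * ∫ θ in (0)..(2 * Real.pi), u k θ) := by
      rw [Real.exp_add]
      refine (hj.trans h1).trans ?_
      gcongr
    have h4 := Real.exp_le_exp.1 h3
    have h5 : -(W k) ≤ (2 * Real.pi)⁻¹ * ∫ θ in (0)..(2 * Real.pi), u k θ := by linarith [hWge k]
    have h6 := mul_le_mul_of_nonneg_left h5 hpi.le
    rw [mul_inv_cancel_left₀ hpi.ne'] at h6
    linarith
  set μ := MeasureTheory.volume.restrict (Ioc 0 (2 * Real.pi)) with hμ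
  have hae := ae_choice (μ := μ) (fun k θ => (W k - u k θ) / W k) (C := 4 * Real.pi) ?_ ?_ ?_
  · have hroot : ∀ᵐ θ : ℝ ∂μ, ∀ k, (q k).eval (circleMap 0 1 θ) ≠ 0 := by
      rw [MeasureTheory.ae_all_iff]
      intro k
      refine MeasureTheory.ae_restrict_of_ae ?_
      have hc : ((circleMap 0 1) ⁻¹' ((q k).roots.toFinset : Set ℂ)).Countable :=
        Set.Countable.preimage_circleMap (Finset.countable_toSet _) 0 one_ne_zero
      filter_upwards [hc.ae_notMem MeasureTheory.volume] with θ hθ h0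
      apply hθ
      simp [hne k, h0]
    have hμne : (MeasureTheory.ae μ).NeBot := by
      rw [MeasureTheory.ae_neBot, hμ, Ne, MeasureTheory.Measure.restrict_eq_zero, Real.volume_Ioc]
      simp [Real.pi_pos]
    obtain ⟨θ, ⟨T, hT0', hT⟩, hθ⟩ := (hae.and hroot).exists
    refine ⟨circleMap 0 1 θ, by simp [norm_circleMap_zero], T * (T0 + 1), by positivity, fun k => ?_⟩
    rw [← Real.le_log_iff_exp_le (norm_pos_iff.2 (hθ k))]
    have h1 := hT k
    rw [div_le_iff₀ (hWpos k)] at h1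
    change _ ≤ u k θ
    have h2 : T * (T0 + 1) * (2 * ρ) ^ k * d k = T * 2 ^ k * W k := by
      simp only [hW]; rw [mul_pow]; ring
    rw [h2]
    linarith [hWpos k]
  · intro k
    have := (((intervalIntegrable_iff_integrableOn_Ioc_of_le hpi.le).1 (hintg k)))
    refine MeasureTheory.Integrable.div_const ?_ _
    exact (MeasureTheory.integrable_const _).sub this
  · intro k θ
    exact div_nonneg (by linarith [hupper k θ]) (hWpos k).le
  · intro k
    have h1 : ∫ θ, (W k - u k θ) / W k ∂μ = ∫ θ in (0)..(2 * Real.pi), (W k - u k θ) / W k := by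
      rw [intervalIntegral.integral_of_le hpi.le]
    rw [h1, intervalIntegral.integral_div, div_le_iff₀ (hWpos k),
      intervalIntegral.integral_sub (by simp) (hintg k)]
    simp only [intervalIntegral.integral_const, sub_zero, smul_eq_mul]
    linarith [hlower k]

lemma mpoly_cons {n d : ℕ} (c : (Fin (n+1) → Fin (d+1)) → ℂ) (x : ℂ) (z : Fin n → ℂ) :
    mpoly c (Fin.cons x z) =
      mpoly (fun a : Fin n → Fin (d+1) => ∑ j : Fin (d+1), c (Fin.cons j a) * x ^ (j : ℕ)) z := by
  unfold mpoly
  rw [← (Fin.consEquiv (fun _ : Fin (n+1) => Fin (d+1))).sum_comp, Fintype.sum_prod_type,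
    Finset.sum_comm]
  refine Finset.sum_congr rfl fun a _ => ?_
  rw [Finset.sum_mul]
  refine Finset.sum_congr rfl fun j _ => ?_
  simp [Fin.consEquiv, Fin.prod_univ_succ]
  ring

theorem multi_choice (n : ℕ) : ∀ (d : ℕ → ℕ) (_ : ∀ k, 1 ≤ d k)
    (c : ∀ k, (Fin n → Fin (d k + 1)) → ℂ) {T0 ρ : ℝ} (_ : 0 ≤ T0) (_ : 1 ≤ ρ)
    (_ : ∀ k, ‖c k‖ ≤ Real.exp (T0 * ρ ^ k * d k))
    (_ : ∀ k, Real.exp (-(T0 * ρ ^ k * d k)) ≤ ‖c k‖),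
    ∃ z : Fin n → ℂ, ∃ T : ℝ, 0 ≤ T ∧
      ∀ k, Real.exp (-(T * (2 ^ n * ρ) ^ k * d k)) ≤ ‖mpoly (c k) z‖ := by
  induction n with
  | zero =>
    intro d hd c T0 ρ hT0 hρ hup hlo
    refine ⟨0, T0, hT0, fun k => ?_⟩
    have h1 : mpoly (c k) 0 = c k 0 := by
      simp [mpoly]
      congr 1
    have h2 : ‖c k‖ = ‖c k 0‖ := by
      refine le_antisymm ?_ (norm_le_pi_norm _ _)
      refine (pi_norm_le_iff_of_nonneg (norm_nonneg _)).2 fun a => ?_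
      rw [Subsingleton.elim a 0]
    rw [h1, ← h2]
    simpa using hlo k
  | succ n ih =>
    intro d hd c T0 ρ hT0 hρ hup hlo
    have hmax : ∀ k, ∃ a, ‖c k‖ = ‖c k a‖ := by
      intro k
      obtain ⟨a, -, ha⟩ := Finset.exists_max_image Finset.univ (fun a => ‖c k a‖) Finset.univ_nonempty
      refine ⟨a, le_antisymm ?_ (norm_le_pi_norm _ _)⟩
      exact (pi_norm_le_iff_of_nonneg (norm_nonneg _)).2 fun b => ha b (Finset.mem_univ _)
    choose a ha using hmax
    set q : ℕ → ℂ[X] := fun k => ∑ j : Fin (d k + 1),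
      monomial (j : ℕ) (c k (Fin.cons j (Fin.tail (a k)))) with hq
    have hcoeff : ∀ k (j : Fin (d k + 1)), (q k).coeff j = c k (Fin.cons j (Fin.tail (a k))) := by
      intro k j
      simp only [hq, finsetSum_coeff, coeff_monomial]
      simp [Fin.val_inj]
    have hcoeff2 : ∀ k (j : ℕ), ¬ j < d k + 1 → (q k).coeff j = 0 := by
      intro k j hj
      simp only [hq, finsetSum_coeff, coeff_monomial]
      refine Finset.sum_eq_zero fun i _ => ?_
      rw [if_neg]; have := i.2; omega
    have hdeg : ∀ k, (q k).natDegree ≤ d k := by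
      intro k
      rw [natDegree_le_iff_coeff_eq_zero]
      intro j hj
      exact hcoeff2 k j (by omega)
    have heval : ∀ k x, (q k).eval x = ∑ j : Fin (d k + 1), c k (Fin.cons j (Fin.tail (a k))) * x ^ (j : ℕ) := by
      intro k x
      simp [hq, eval_finsetSum]
    have hch := circle_choice d hd q hdeg hT0 hρ ?_ ?_
    · obtain ⟨x, hx, T, hT, hTx⟩ := hch
      set c' : ∀ k, (Fin n → Fin (d k + 1)) → ℂ := fun k b =>
        ∑ j : Fin (d k + 1), c k (Fin.cons j b) * x ^ (j : ℕ) with hc'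
      have hbound : ∀ k, ‖c' k‖ ≤ Real.exp ((T0 + 1 + T) * (2 * ρ) ^ k * d k) := by
        intro k
        refine (pi_norm_le_iff_of_nonneg (Real.exp_pos _).le).2 fun b => ?_
        have hd' : (1:ℝ) ≤ d k := by exact_mod_cast hd k
        calc ‖c' k b‖ ≤ ∑ j : Fin (d k + 1), ‖c k‖ := by
              refine (norm_sum_le _ _).trans (Finset.sum_le_sum fun j _ => ?_)
              rw [norm_mul, norm_pow, hx, one_pow, mul_one]
              exact norm_le_pi_norm _ _
          _ = ((d k : ℝ) + 1) * ‖c k‖ := by simp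
          _ ≤ Real.exp (d k) * Real.exp (T0 * ρ ^ k * d k) := by
              gcongr
              · exact Real.add_one_le_exp _
              · exact hup k
          _ ≤ _ := by
              rw [← Real.exp_add]
              refine Real.exp_le_exp.2 ?_
              have h1 : ρ ^ k ≤ (2 * ρ) ^ k := by gcongr; linarith
              have h2 : 1 ≤ (2 * ρ) ^ k := one_le_pow₀ (by linarith)
              have h3 : T0 * ρ ^ k ≤ T0 * (2 * ρ) ^ k := by gcongr
              have h4 : T0 * ρ ^ k * d k ≤ T0 * (2 * ρ) ^ k * d k := by gcongr
              have h5 : 1 * (d k : ℝ) ≤ (2 * ρ) ^ k * d k := by gcongr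
              have h6 : 0 ≤ T * (2 * ρ) ^ k * d k := by positivity
              nlinarith
      obtain ⟨z, T', hT', hz⟩ := ih d hd c' (T0 := T0 + 1 + T) (ρ := 2 * ρ) (by positivity) (by linarith)
        hbound (fun k => by
          refine le_trans ?_ ((hTx k).trans ?_)
          · refine Real.exp_le_exp.2 (neg_le_neg ?_)
            gcongr; linarith
          · rw [heval]
            exact norm_le_pi_norm (c' k) (Fin.tail (a k)))
      refine ⟨Fin.cons x z, T', hT', fun k => ?_⟩
      rw [mpoly_cons]
      have := hz k
      rw [pow_succ, mul_assoc (2 ^ n)]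
      exact this
    · intro k j
      by_cases hj : j < d k + 1
      · have := hcoeff k ⟨j, hj⟩
        simp only at this
        rw [this]
        exact (norm_le_pi_norm _ _).trans (hup k)
      · rw [hcoeff2 k j hj, norm_zero]; exact (Real.exp_pos _).le
    · intro k
      refine ⟨(a k 0 : ℕ), ?_⟩
      rw [hcoeff k (a k 0), Fin.cons_self_tail, ← ha k]
      exact hlo k

/-- finite products -/
def gK {n : ℕ} (d : ℕ → ℕ) (c : ∀ k, (Fin n → Fin (d k + 1)) → ℂ) (K : ℕ) (z : Fin n → ℂ) : ℝ :=
  ∏ k ∈ Finset.range K, ‖mpoly (c k) z‖ ^ ((1:ℝ) / (d k * (2 ^ (n+1)) ^ k))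

/-- the exponent of the growth correction -/
def thK (n K : ℕ) : ℝ := n * (2 * (1 / (2 ^ (n+1)) ^ K))

/-- corrected finite products -/
def hK {n : ℕ} (d : ℕ → ℕ) (c : ∀ k, (Fin n → Fin (d k + 1)) → ℂ) (K : ℕ) (z : Fin n → ℂ) : ℝ :=
  gK d c K z * (2 * max 1 ‖z‖) ^ thK n K

lemma thK_nonneg (n K : ℕ) : 0 ≤ thK n K := by unfold thK; positivity

lemma thK_succ (n K : ℕ) : (n:ℝ) / (2 ^ (n+1)) ^ K + thK n (K+1) ≤ thK n K := by
  unfold thK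
  have h1 : (1:ℝ) / (2 ^ (n+1)) ^ (K+1) ≤ 1/2 * (1 / (2 ^ (n+1)) ^ K) := by
    rw [pow_succ, ← one_div_mul_one_div, mul_comm]
    gcongr
    calc (2:ℝ) = 2 ^ 1 := by norm_num
      _ ≤ 2 ^ (n+1) := pow_le_pow_right₀ (by norm_num) (by omega)
  have h2 : (n:ℝ) * (2 * (1 / (2 ^ (n+1)) ^ (K+1))) ≤ n * (2 * (1/2 * (1 / (2 ^ (n+1)) ^ K))) := by gcongr
  calc _ ≤ (n:ℝ) / (2 ^ (n+1)) ^ K + n * (2 * (1/2 * (1 / (2 ^ (n+1)) ^ K))) := by linarith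
    _ = _ := by ring

lemma thK_anti (n K : ℕ) : thK n (K+1) ≤ thK n K := by
  have := thK_succ n K
  have h : (0:ℝ) ≤ (n:ℝ) / (2 ^ (n+1)) ^ K := by positivity
  linarith

lemma thK_tendsto (n : ℕ) : Filter.Tendsto (thK n) Filter.atTop (nhds 0) := by
  have h1 : Filter.Tendsto (fun K : ℕ => ((1:ℝ) / 2 ^ (n+1)) ^ K) Filter.atTop (nhds 0) := by
    refine tendsto_pow_atTop_nhds_zero_of_lt_one (by positivity) ?_
    rw [div_lt_one (by positivity)]
    exact one_lt_pow₀ (by norm_num) (by omega)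
  have h2 := (h1.const_mul 2).const_mul (n:ℝ)
  have h3 : thK n = fun K : ℕ => (n:ℝ) * (2 * ((1:ℝ) / 2 ^ (n+1)) ^ K) := by
    ext K; simp [thK]
  rw [h3]
  simpa using h2

lemma one_le_base {n : ℕ} (z : Fin n → ℂ) : 1 ≤ 2 * max 1 ‖z‖ := by
  have := le_max_left 1 ‖z‖; linarith

lemma gK_nonneg {n : ℕ} (d : ℕ → ℕ) (c : ∀ k, (Fin n → Fin (d k + 1)) → ℂ) (K : ℕ) (z : Fin n → ℂ) :
    0 ≤ gK d c K z := Finset.prod_nonneg fun k _ => Real.rpow_nonneg (norm_nonneg _) _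

lemma gK_le_hK {n : ℕ} (d : ℕ → ℕ) (c : ∀ k, (Fin n → Fin (d k + 1)) → ℂ) (K : ℕ) (z : Fin n → ℂ) :
    gK d c K z ≤ hK d c K z :=
  le_mul_of_one_le_right (gK_nonneg d c K z) (Real.one_le_rpow (one_le_base z) (thK_nonneg n K))

lemma hK_nonneg {n : ℕ} (d : ℕ → ℕ) (c : ∀ k, (Fin n → Fin (d k + 1)) → ℂ) (K : ℕ) (z : Fin n → ℂ) :
    0 ≤ hK d c K z := (gK_nonneg d c K z).trans (gK_le_hK d c K z)

lemma hK_succ_le {n : ℕ} {d : ℕ → ℕ} (hd : ∀ k, 1 ≤ d k) {c : ∀ k, (Fin n → Fin (d k + 1)) → ℂ}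
    (hc : ∀ k, ‖c k‖ = 1) (K : ℕ) (z : Fin n → ℂ) : hK d c (K+1) z ≤ hK d c K z := by
  have hd0 : (0:ℝ) < d K := by exact_mod_cast hd K
  have hb := one_le_base z
  have hb0 : 0 < 2 * max 1 ‖z‖ := by linarith
  have h1 : ‖mpoly (c K) z‖ ^ ((1:ℝ) / (d K * (2 ^ (n+1)) ^ K)) ≤
      (2 * max 1 ‖z‖) ^ ((n:ℝ) / (2 ^ (n+1)) ^ K) := by
    have h2 := mpoly_bound (c K) z (le_max_left 1 ‖z‖) (le_max_right 1 ‖z‖)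
    rw [hc K, mul_one] at h2
    refine (Real.rpow_le_rpow (norm_nonneg _) h2 (by positivity)).trans (le_of_eq ?_)
    rw [← Real.rpow_natCast, ← Real.rpow_mul hb0.le]
    congr 1
    push_cast
    field_simp
  unfold hK gK
  rw [Finset.prod_range_succ, mul_assoc]
  refine mul_le_mul_of_nonneg_left ?_ (gK_nonneg d c K z)
  calc _ ≤ (2 * max 1 ‖z‖) ^ ((n:ℝ) / (2 ^ (n+1)) ^ K) * (2 * max 1 ‖z‖) ^ thK n (K+1) := by gcongr
    _ = (2 * max 1 ‖z‖) ^ ((n:ℝ) / (2 ^ (n+1)) ^ K + thK n (K+1)) := by rw [Real.rpow_add hb0]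
    _ ≤ _ := Real.rpow_le_rpow_of_exponent_le hb (thK_succ n K)

lemma hK_succ_small {n : ℕ} {d : ℕ → ℕ} (hd : ∀ k, 1 ≤ d k) {c : ∀ k, (Fin n → Fin (d k + 1)) → ℂ}
    (K : ℕ) (z : Fin n → ℂ)
    (h : ‖mpoly (c K) z‖ ≤ Real.exp (-((2 ^ (n+1)) ^ K * d K))) :
    hK d c (K+1) z ≤ Real.exp (-1) * hK d c K z := by
  have hd0 : (0:ℝ) < d K := by exact_mod_cast hd K
  have hb := one_le_base z
  have h1 : ‖mpoly (c K) z‖ ^ ((1:ℝ) / (d K * (2 ^ (n+1)) ^ K)) ≤ Real.exp (-1) := by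
    refine (Real.rpow_le_rpow (norm_nonneg _) h (by positivity)).trans (le_of_eq ?_)
    rw [← Real.exp_mul]
    congr 1
    field_simp
  unfold hK gK
  rw [Finset.prod_range_succ]
  have h0 := gK_nonneg d c K z
  unfold gK at h0
  have h3 := Real.rpow_le_rpow_of_exponent_le hb (thK_anti n K)
  calc _ ≤ (∏ k ∈ Finset.range K, ‖mpoly (c k) z‖ ^ ((1:ℝ) / (d k * (2 ^ (n+1)) ^ k))) * Real.exp (-1)
        * (2 * max 1 ‖z‖) ^ thK n K := by gcongr
    _ = _ := by ring

lemma gK_cont {n : ℕ} {d : ℕ → ℕ} (c : ∀ k, (Fin n → Fin (d k + 1)) → ℂ) (K : ℕ) :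
    Continuous (gK d c K) := by
  unfold gK
  refine continuous_finsetProd _ fun k _ => ?_
  exact (mpoly_diff (c k)).continuous.norm.rpow_const fun z => Or.inr (by positivity)

lemma hK_cont {n : ℕ} {d : ℕ → ℕ} (c : ∀ k, (Fin n → Fin (d k + 1)) → ℂ) (K : ℕ) :
    Continuous (hK d c K) := by
  unfold hK
  refine (gK_cont c K).mul ?_
  exact (by fun_prop : Continuous fun z : Fin n → ℂ => 2 * max 1 ‖z‖).rpow_const
    fun z => Or.inr (thK_nonneg n K)

lemma gK_entire {n : ℕ} {d : ℕ → ℕ} (hd : ∀ k, 1 ≤ d k) (c : ∀ k, (Fin n → Fin (d k + 1)) → ℂ)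
    (a b : Fin n → ℂ) (K : ℕ) : ∃ Q : ℕ, Q ≠ 0 ∧ ∃ f : ℂ → ℂ, Differentiable ℂ f ∧
      ∀ t : ℂ, gK d c K (a + t • b) ^ Q = ‖f t‖ := by
  induction K with
  | zero => exact ⟨1, one_ne_zero, fun _ => 1, by fun_prop, by simp [gK]⟩
  | succ K ih =>
    obtain ⟨Q, hQ, f, hf, hfg⟩ := ih
    obtain ⟨m, hm⟩ : ∃ m, m = d K * (2 ^ (n+1)) ^ K := ⟨_, rfl⟩
    have hm0 : m ≠ 0 := by
      have := hd K
      rw [hm]; positivity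
    refine ⟨Q * m, mul_ne_zero hQ hm0, fun t => f t ^ m * mpoly (c K) (a + t • b) ^ Q, ?_, fun t => ?_⟩
    · have := mpoly_diff (c K)
      fun_prop
    · have h1 : gK d c (K+1) (a + t • b) = gK d c K (a + t • b) *
          ‖mpoly (c K) (a + t • b)‖ ^ ((m : ℝ)⁻¹) := by
        unfold gK
        rw [Finset.prod_range_succ, hm]; push_cast; rw [one_div]
      show _ = ‖f t ^ m * mpoly (c K) (a + t • b) ^ Q‖
      rw [h1, mul_pow, pow_mul _ Q m, hfg, mul_comm Q m, pow_mul _ m Q,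
        Real.rpow_inv_natCast_pow (norm_nonneg _) hm0, norm_mul, norm_pow, norm_pow]

lemma gK_max {n : ℕ} {d : ℕ → ℕ} (hd : ∀ k, 1 ≤ d k) (c : ∀ k, (Fin n → Fin (d k + 1)) → ℂ)
    (a b : Fin n → ℂ) (K : ℕ) (x : ℂ) (r : ℝ) (hr : 0 < r) (p : ℂ[X]) (ε : ℝ)
    (h : ∀ t ∈ sphere x r, gK d c K (a + t • b) ≤ Real.exp ((p.eval t).re + ε)) :
    ∀ t ∈ closedBall x r, gK d c K (a + t • b) ≤ Real.exp ((p.eval t).re + ε) := by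
  obtain ⟨Q, hQ, f, hf, hfg⟩ := gK_entire hd c a b K
  have hn : ∀ t, ‖f t * Complex.exp (-(Q * (p.eval t + ε)))‖ =
      gK d c K (a + t • b) ^ Q * (Real.exp ((p.eval t).re + ε) ^ Q)⁻¹ := by
    intro t
    rw [norm_mul, ← hfg, Complex.norm_exp, ← Real.exp_nat_mul, ← Real.exp_neg]
    simp
  have hd : Differentiable ℂ fun t => f t * Complex.exp (-(Q * (p.eval t + ε))) := by
    have := p.differentiable
    fun_prop
  intro t ht
  have := Complex.norm_le_of_forall_mem_frontier_norm_le (isBounded_ball (x := x) (r := r))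
    hd.diffContOnCl (C := 1) (fun t ht => by
      rw [frontier_ball _ hr.ne'] at ht
      rw [hn, ← div_eq_mul_inv, div_le_one (by positivity)]
      exact pow_le_pow_left₀ (gK_nonneg _ _ _ _) (h t ht) _) (by rwa [closure_ball _ hr.ne'])
  rw [hn, ← div_eq_mul_inv, div_le_one (by positivity)] at this
  exact le_of_pow_le_pow_left₀ hQ (Real.exp_pos _).le this

/-- log of a nonnegative real as an extended real -/
def elog (x : ℝ) : EReal := ENNReal.log (ENNReal.ofReal x)

lemma elog_exp (x : ℝ) : elog (Real.exp x) = (x : EReal) := by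
  unfold elog
  rw [ENNReal.log_ofReal_of_pos (Real.exp_pos x), Real.log_exp]

lemma elog_mono {x y : ℝ} (h : x ≤ y) : elog x ≤ elog y :=
  ENNReal.log_monotone (ENNReal.ofReal_le_ofReal h)

lemma elog_lt {x y : ℝ} (h : elog x < (y : EReal)) : x < Real.exp y := by
  by_contra h2
  have := elog_mono (not_lt.1 h2)
  rw [elog_exp] at this
  exact absurd h (not_lt.2 this)

lemma elog_cont : Continuous elog := ENNReal.continuous_log.comp ENNReal.continuous_ofReal

theorem psh_of_seq {n : ℕ} (d : ℕ → ℕ) (hd : ∀ k, 1 ≤ d k)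
    (c : ∀ k, (Fin n → Fin (d k + 1)) → ℂ) (hc : ∀ k, ‖c k‖ = 1) :
    ∃ u : (Fin n → ℂ) → EReal, Plurisubharmonic u ∧ (¬ ∀ z, u z = ⊥) ∧
      ∀ z, (∃ᶠ k in Filter.atTop, ‖mpoly (c k) z‖ ≤ Real.exp (-((2 ^ (n+1)) ^ k * d k))) → u z = ⊥ := by
  have hanti : ∀ z, Antitone fun K => hK d c K z := fun z =>
    antitone_nat_of_succ_le fun K => hK_succ_le hd hc K z
  set u : (Fin n → ℂ) → EReal := fun z => ⨅ K, elog (hK d c K z) with hu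
  have hule : ∀ K z, u z ≤ elog (hK d c K z) := fun K z => iInf_le _ K
  have husc : UpperSemicontinuous u :=
    upperSemicontinuous_iInf fun K => (elog_cont.comp (hK_cont c K)).upperSemicontinuous
  refine ⟨u, ⟨husc, ?_, ?_⟩, ?_, ?_⟩
  · intro z h
    have := hule 0 z
    rw [h, top_le_iff] at this
    simp only [elog, ENNReal.log_eq_top_iff, ENNReal.ofReal_ne_top] at this
  · intro a b
    have haff : Continuous fun t : ℂ => a + t • b := by fun_prop
    refine ⟨(husc.comp haff).upperSemicontinuousOn _, ?_⟩
    intro x r hr _ p hp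
    -- main estimate
    have key : ∀ ε > 0, ∀ t ∈ closedBall x r, u (a + t • b) ≤ (((p.eval t).re + ε + ε : ℝ) : EReal) := by
      intro ε hε t ht
      have hpc : Continuous fun t : ℂ => Real.exp ((p.eval t).re + ε) := by
        have := p.continuous
        fun_prop
      obtain ⟨K0, hK0⟩ := (isCompact_sphere x r).elim_directed_cover
        (fun K => {t : ℂ | hK d c K (a + t • b) < Real.exp ((p.eval t).re + ε)})
        (fun K => isOpen_lt ((hK_cont c K).comp haff) hpc)
        (fun t ht => by
          have h1 : u (a + t • b) < (((p.eval t).re + ε : ℝ) : EReal) :=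
            (hp t ht).trans_lt (by exact_mod_cast (by linarith : (p.eval t).re < (p.eval t).re + ε))
          obtain ⟨K, hK⟩ := iInf_lt_iff.1 h1
          exact mem_iUnion.2 ⟨K, elog_lt hK⟩)
        (directed_of_isDirected_le fun i j hij t ht => lt_of_le_of_lt (hanti _ hij) ht)
      obtain ⟨M0, hM0⟩ := (isCompact_closedBall x r).exists_bound_of_continuousOn haff.continuousOn
      set M := max 1 M0
      have hM1 : 1 ≤ M := le_max_left _ _
      have hlim : Filter.Tendsto (fun K => (2 * M) ^ thK n K) Filter.atTop (nhds 1) := by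
        have := (Real.continuousAt_const_rpow (a := 2 * M) (b := 0) (by linarith)).tendsto.comp (thK_tendsto n)
        rw [Real.rpow_zero] at this
        exact this
      have hev := hlim.eventually_lt_const (Real.one_lt_exp_iff.2 hε)
      obtain ⟨K, hKε, hKK⟩ := (hev.and (Filter.eventually_ge_atTop K0)).exists
      have hg := gK_max hd c a b K x r hr p ε (fun t ht =>
        ((gK_le_hK d c K _).trans (hanti _ hKK)).trans (le_of_lt (hK0 ht))) t ht
      refine (hule K _).trans ?_
      rw [← elog_exp]
      refine elog_mono ?_
      rw [Real.exp_add]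
      unfold hK
      refine mul_le_mul hg ?_ (Real.rpow_nonneg (by positivity) _) (Real.exp_pos _).le
      refine le_trans ?_ hKε.le
      refine Real.rpow_le_rpow (by positivity) ?_ (thK_nonneg n K)
      have : ‖a + t • b‖ ≤ M0 := hM0 t ht
      gcongr
      exact max_le_max le_rfl this
    intro t ht
    by_contra hlt
    obtain ⟨y, hy1, hy2⟩ := EReal.lt_iff_exists_real_btwn.1 (not_le.1 hlt)
    have hy1' : (p.eval t).re < y := by exact_mod_cast hy1
    have := key ((y - (p.eval t).re) / 2) (by linarith) t ht
    rw [show (p.eval t).re + (y - (p.eval t).re) / 2 + (y - (p.eval t).re) / 2 = y by ring] at this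
    exact absurd hy2 (not_lt.2 this)
  · obtain ⟨z, T, hT, hz⟩ := multi_choice n d hd c (T0 := 0) (ρ := 1) le_rfl le_rfl
      (fun k => by simp [hc k]) (fun k => by simp [hc k])
    intro hbot
    have hlow : ∀ K, Real.exp (-(2 * T)) ≤ hK d c K z := by
      intro K
      refine le_trans ?_ (gK_le_hK d c K z)
      have hterm : ∀ k, Real.exp (-(T * (1/2)^k)) ≤
          ‖mpoly (c k) z‖ ^ ((1:ℝ) / (d k * (2 ^ (n+1)) ^ k)) := by
        intro k
        have hd0 : (0:ℝ) < d k := by exact_mod_cast hd k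
        refine le_trans (le_of_eq ?_) (Real.rpow_le_rpow (Real.exp_pos _).le (hz k) (by positivity))
        rw [← Real.exp_mul]
        congr 1
        rw [mul_one, pow_succ, mul_pow, div_pow, one_pow]
        field_simp
      calc Real.exp (-(2 * T)) ≤ Real.exp (∑ k ∈ Finset.range K, -(T * (1/2)^k)) := by
            refine Real.exp_le_exp.2 ?_
            rw [Finset.sum_neg_distrib, ← Finset.mul_sum]
            have := sum_geometric_two_le K
            nlinarith
        _ = ∏ k ∈ Finset.range K, Real.exp (-(T * (1/2)^k)) := Real.exp_sum _ _
        _ ≤ _ := Finset.prod_le_prod (fun k _ => (Real.exp_pos _).le) fun k _ => hterm k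
    have h1 : ((-(2 * T) : ℝ) : EReal) ≤ u z := by
      refine le_iInf fun K => ?_
      rw [← elog_exp]
      exact elog_mono (hlow K)
    rw [hbot z, le_bot_iff] at h1
    exact EReal.coe_ne_bot _ h1
  · intro z hz
    have hsmall : ∀ j : ℕ, ∃ K, hK d c K z ≤ Real.exp (-1) ^ j * hK d c 0 z := by
      intro j
      induction j with
      | zero => exact ⟨0, by simp⟩
      | succ j ih =>
        obtain ⟨K, hKj⟩ := ih
        obtain ⟨k, hk, hkz⟩ := Filter.frequently_atTop.1 hz K
        refine ⟨k + 1, (hK_succ_small hd k z hkz).trans ?_⟩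
        rw [pow_succ', mul_assoc]
        exact mul_le_mul_of_nonneg_left ((hanti z hk).trans hKj) (Real.exp_pos _).le
    rw [EReal.eq_bot_iff_forall_lt]
    intro y
    have hlim : Filter.Tendsto (fun j : ℕ => Real.exp (-1) ^ j * hK d c 0 z) Filter.atTop (nhds 0) := by
      have := (tendsto_pow_atTop_nhds_zero_of_lt_one (Real.exp_pos (-1)).le
        (Real.exp_lt_one_iff.2 (by norm_num))).mul_const (hK d c 0 z)
      simpa using this
    obtain ⟨j, hj⟩ := (hlim.eventually_lt_const (Real.exp_pos (y - 1))).exists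
    obtain ⟨K, hKj⟩ := hsmall j
    refine (hule K z).trans_lt ((elog_mono (hKj.trans hj.le)).trans_lt ?_)
    rw [elog_exp]
    exact_mod_cast (by linarith : y - 1 < y)

lemma line_diff {n : ℕ} {D : Set (Fin n → ℂ)} (hD : IsOpen D) {ψ : (Fin n → ℂ) → ℂ}
    (hψ : ContinuousOn ψ D) (hol : DifferentiableOn ℂ ψ (D \ ψ ⁻¹' {0})) (a b : Fin n → ℂ) (t : ℂ)
    (ht : a + t • b ∈ D) : DifferentiableAt ℂ (fun t : ℂ => ψ (a + t • b)) t := by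
  have haff : Continuous fun t : ℂ => a + t • b := by fun_prop
  have hU : IsOpen {t : ℂ | a + t • b ∈ D} := hD.preimage haff
  have hO : IsOpen (D \ ψ ⁻¹' {0}) := by
    have := hψ.isOpen_inter_preimage hD (isOpen_compl_singleton (x := (0:ℂ)))
    exact this
  refine (rado hU (hψ.comp haff.continuousOn fun t ht => ht) ?_).differentiableAt (hU.mem_nhds ht)
  intro z hz hz0
  have h1 : DifferentiableAt ℂ ψ (a + z • b) :=
    hol.differentiableAt (hO.mem_nhds ⟨hz, fun h => hz0 h⟩)
  exact h1.comp z (f := fun t : ℂ => a + t • b) (by fun_prop)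

lemma zero_dichotomy {n : ℕ} {D : Set (Fin n → ℂ)} (hD : IsOpen D) (hDc : IsPreconnected D)
    {ψ : (Fin n → ℂ) → ℂ}
    (hline : ∀ a b, ∀ t : ℂ, a + t • b ∈ D → DifferentiableAt ℂ (fun t : ℂ => ψ (a + t • b)) t)
    {q : Fin n → ℂ} (hq : q ∈ D) (hq0 : ψ q ≠ 0) {p : Fin n → ℂ} (hp : p ∈ D) {r : ℝ} (hr : 0 < r) :
    ∃ x ∈ ball p r, ψ x ≠ 0 := by
  by_contra! hcon
  set I : Set (Fin n → ℂ) := {x | ∀ᶠ y in nhds x, ψ y = 0} with hI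
  have hIo : IsOpen I := isOpen_setOfPred_eventually_nhds
  have hpI : p ∈ I := Filter.mem_of_superset (ball_mem_nhds p hr) hcon
  have hsub : closure I ∩ D ⊆ I := by
    rintro x ⟨hxI, hxD⟩
    obtain ⟨ρ, hρ, hball⟩ := Metric.isOpen_iff.1 hD x hxD
    obtain ⟨y, hyI, hyx⟩ := Metric.mem_closure_iff.1 hxI ρ hρ
    have hyb : y ∈ ball x ρ := by rwa [mem_ball, dist_comm]
    refine Filter.mem_of_superset (ball_mem_nhds x hρ) fun z hz => ?_
    have haff : Continuous fun t : ℂ => y + t • (z - y) := by fun_prop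
    set V : Set ℂ := {t | y + t • (z - y) ∈ ball x ρ} with hV
    have hVo : IsOpen V := isOpen_ball.preimage haff
    have hVc : Convex ℝ V := by
      intro s hs t ht α β hα hβ hαβ
      have := convex_ball x ρ hs ht hα hβ hαβ
      show y + (α • s + β • t) • (z - y) ∈ ball x ρ
      convert this using 1
      obtain rfl : β = 1 - α := by linarith
      ext i
      simp
      ring
    have hdiff : DifferentiableOn ℂ (fun t : ℂ => ψ (y + t • (z - y))) V := fun t ht =>
      (hline y (z - y) t (hball ht)).differentiableWithinAt
    have h0 : (0:ℂ) ∈ V := by simpa [hV] using hyb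
    have h1 : (1:ℂ) ∈ V := by simpa [hV] using hz
    have hev : (fun t : ℂ => ψ (y + t • (z - y))) =ᶠ[nhds 0] 0 := by
      have h2 : Filter.Tendsto (fun t : ℂ => y + t • (z - y)) (nhds 0) (nhds y) := by
        have := haff.tendsto 0
        simpa using this
      exact h2.eventually hyI
    have := (hdiff.analyticOnNhd hVo).eqOn_zero_of_preconnected_of_eventuallyEq_zero
      hVc.isPreconnected h0 hev h1
    simpa using this
  have := hDc.subset_of_closure_inter_subset hIo ⟨p, hp, hpI⟩ hsub hq
  exact hq0 this.self_of_nhds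

lemma local_all {n : ℕ} {D : Set (Fin n → ℂ)} (hD : IsOpen D) {ψ : (Fin n → ℂ) → ℂ}
    (hψ : ContinuousOn ψ D)
    (hline : ∀ a b, ∀ t : ℂ, a + t • b ∈ D → DifferentiableAt ℂ (fun t : ℂ => ψ (a + t • b)) t)
    {p : Fin n → ℂ} (hp : p ∈ D) (hnz : ∀ r > 0, ∃ x ∈ ball p r, ψ x ≠ 0) :
    ∃ U, IsOpen U ∧ p ∈ U ∧ ∀ A : ℝ, ∃ d : ℕ, 1 ≤ d ∧ ∃ c : (Fin n → Fin (d+1)) → ℂ, ‖c‖ = 1 ∧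
      ∀ z ∈ U, ψ z = 0 → ‖mpoly c z‖ ≤ Real.exp (-(A * d)) := by
  by_cases hp0 : ψ p = 0
  · cases n with
    | zero =>
      obtain ⟨x, -, hx⟩ := hnz 1 one_pos
      exact absurd (by rw [Subsingleton.elim x p, hp0]) hx
    | succ N => exact local_geom hD hψ hline hp hp0 hnz
  · refine ⟨D ∩ ψ ⁻¹' {0}ᶜ, hψ.isOpen_inter_preimage hD isOpen_compl_singleton, ⟨hp, hp0⟩,
      fun A => ⟨1, le_rfl, fun _ => 1, ?_, fun z hz h => absurd h hz.2⟩⟩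
    simp [pi_norm_const]

/-- If a continuous `ψ : D → ℂ`, holomorphic off its zero set, vanishes on a
non-pluripolar subset of the domain `D`, then `ψ ≡ 0` on `D`. -/
theorem eq_zero_of_vanishing_on_nonpluripolar
    {n : ℕ} (D : Set (Fin n → ℂ))
    (hDopen : IsOpen D) (hDconn : IsConnected D)
    (ψ : (Fin n → ℂ) → ℂ) (hψ : ContinuousOn ψ D)
    (hol : DifferentiableOn ℂ ψ (D \ ψ ⁻¹' {0}))
    (S : Set (Fin n → ℂ)) (hSD : S ⊆ D) (hS : ¬ Pluripolar S)
    (hvan : ∀ z ∈ S, ψ z = 0) :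
    ∀ z ∈ D, ψ z = 0 := by
  by_contra! hcon
  obtain ⟨q, hq, hq0⟩ := hcon
  have hline := line_diff hDopen hψ hol
  have hloc : ∀ p : Fin n → ℂ, ∃ U : Set (Fin n → ℂ), p ∈ D → (IsOpen U ∧ p ∈ U ∧
      ∀ A : ℝ, ∃ d : ℕ, 1 ≤ d ∧ ∃ c : (Fin n → Fin (d+1)) → ℂ, ‖c‖ = 1 ∧
      ∀ z ∈ U, ψ z = 0 → ‖mpoly c z‖ ≤ Real.exp (-(A * d))) := by
    intro p
    by_cases hp : p ∈ D
    · obtain ⟨U, h⟩ := local_all hDopen hψ hline hp fun r hr =>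
        zero_dichotomy hDopen hDconn.isPreconnected hline hq hq0 hp hr
      exact ⟨U, fun _ => h⟩
    · exact ⟨∅, fun h => absurd h hp⟩
  choose U hU using hloc
  obtain ⟨T, hTD, hTc, hcov⟩ := TopologicalSpace.countable_cover_nhdsWithin (f := U) (s := D)
    (fun p hp => mem_nhdsWithin_of_mem_nhds ((hU p hp).1.mem_nhds (hU p hp).2.1))
  have hTne : T.Nonempty := by
    obtain ⟨i, hi, -⟩ := mem_iUnion₂.1 (hcov hq)
    exact ⟨i, hi⟩
  obtain ⟨e, he⟩ := hTc.exists_eq_range hTne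
  have heD : ∀ j, e j ∈ D := fun j => hTD (he ▸ mem_range_self j)
  choose d hd c hc hsmall using fun k : ℕ =>
    (hU (e (Nat.unpair k).1) (heD _)).2.2 ((2 ^ (n+1)) ^ k)
  obtain ⟨u, hu, hne, hbot⟩ := psh_of_seq d hd c hc
  refine hS ⟨u, hu, hne, fun z hz => hbot z ?_⟩
  obtain ⟨i, hi, hzi⟩ := mem_iUnion₂.1 (hcov (hSD hz))
  rw [he] at hi
  obtain ⟨j, rfl⟩ := hi
  refine Filter.frequently_atTop.2 fun m => ⟨Nat.pair j m, Nat.right_le_pair j m, ?_⟩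
  refine hsmall _ z ?_ (hvan z hz)
  rwa [Nat.unpair_pair]
end
end

section
/- Let D be a domain in ℂⁿ, let B ⊆ D be a closed subset of D that is pluripolar in ℂⁿ, and let f : D → ℂ be a continuous function that is holomorphic on D ∖ B. Then f is holomorphic on D. -/
open Metric Set Polynomial

noncomputable section

section helpers

open Filter Topology Complex

/-- Centre version of the maximum principle against real parts of holomorphic functions. -/
lemma sub_le_re {u : ℂ → EReal} (hu : SubharmonicOn u univ) {c : ℂ} {r R : ℝ} (hr : 0 < r)
    (hrR : r < R) {F : ℂ → ℂ} (hF : DifferentiableOn ℂ F (ball c R))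
    (hle : ∀ z ∈ sphere c r, u z ≤ (((F z).re : ℝ) : EReal)) :
    u c ≤ (((F c).re : ℝ) : EReal) := by
  obtain ⟨R', hrR', hR'R⟩ := exists_between hrR
  obtain ⟨r', hrr', hr'R'⟩ := exists_between hrR'
  have hR'0 : 0 < R' := hr.trans hrR'
  have hr'0 : 0 < r' := hr.trans hrr'
  lift R' to NNReal using hR'0.le
  lift r' to NNReal using hr'0.le
  have hps := (hF.mono (closedBall_subset_ball hR'R)).hasFPowerSeriesOnBall
    (by exact_mod_cast hR'0)
  have hunif := hps.tendstoUniformlyOn' (r' := r') (by exact_mod_cast hr'R')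
  rw [Metric.tendstoUniformlyOn_iff] at hunif
  refine EReal.le_of_forall_lt_iff_le.1 ?_
  intro x hx
  have hx' : (F c).re < x := by exact_mod_cast hx
  obtain ⟨N, hN⟩ := (hunif ((x - (F c).re) / 2) (by linarith)).exists
  set ps := cauchyPowerSeries F c R' with hpsdef
  let p : Polynomial ℂ := (∑ k ∈ Finset.range N, C (ps.coeff k) * (X - C c) ^ k)
    + C (((x - (F c).re) / 2 : ℝ) : ℂ)
  have hp : ∀ z, p.eval z = ps.partialSum N (z - c) + (((x - (F c).re) / 2 : ℝ) : ℂ) := by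
    intro z
    simp only [p, eval_add, eval_finsetSum, eval_mul, eval_C, eval_pow, eval_sub, eval_X,
      FormalMultilinearSeries.partialSum, FormalMultilinearSeries.apply_eq_pow_smul_coeff,
      smul_eq_mul]
    congr 1
    exact Finset.sum_congr rfl fun _ _ => mul_comm _ _
  have key : ∀ z ∈ ball c (r' : ℝ), |(F z).re - (ps.partialSum N (z - c)).re| <
      (x - (F c).re) / 2 := by
    intro z hz
    have h := hN z hz
    rw [dist_eq_norm] at h
    rw [← sub_re]
    exact (abs_re_le_norm _).trans_lt h
  have h1 := hu.2 c r hr (subset_univ _) p (fun z hz => (hle z hz).trans (by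
    have h2 := abs_lt.1 (key z (by rw [mem_ball, mem_sphere.1 hz]; exact hrr'))
    rw [hp z, add_re, ofReal_re]
    exact_mod_cast (by linarith [h2.1, h2.2]))) c (by simp [hr.le])
  refine h1.trans ?_
  have h2 := abs_lt.1 (key c (by simpa using hr'0))
  rw [hp c, add_re, ofReal_re]
  exact_mod_cast (by linarith [h2.1, h2.2])

/-- an upper bound on compact sets -/
lemma exists_bound {u : ℂ → EReal} (hu : SubharmonicOn u univ) (ht : ∀ z, u z ≠ ⊤)
    {K : Set ℂ} (hK : IsCompact K) : ∃ M : ℝ, ∀ z ∈ K, u z < (M : EReal) := by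
  rcases K.eq_empty_or_nonempty with rfl | hne
  · exact ⟨0, by simp⟩
  · obtain ⟨a, -, ha⟩ := (hu.1.mono (subset_univ K)).exists_isMaxOn hne hK
    obtain ⟨M, hM⟩ := EReal.lt_iff_exists_real_btwn.1 (lt_top_iff_ne_top.2 (ht a))
    exact ⟨M, fun z hz => (ha hz).trans_lt hM.1⟩

lemma herglotz_re (s : ℝ) (ζ : ℂ) :
    ((1 + s * ζ) / (1 - s * ζ)).re = (1 - s ^ 2 * ‖ζ‖ ^ 2) / ‖1 - s * ζ‖ ^ 2 := by
  rw [div_re, ← normSq_eq_norm_sq, ← normSq_eq_norm_sq, ← add_div]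
  congr 1
  simp [normSq_apply]
  ring

lemma eq_bot_of_ball {u : ℂ → EReal} (hu : SubharmonicOn u univ) (ht : ∀ z, u z ≠ ⊤)
    {a : ℂ} {ρ : ℝ} (hρ : 0 < ρ) (ha : ∀ z ∈ ball a ρ, u z = ⊥) (b : ℂ) : u b = ⊥ := by
  by_contra hb
  have hab : a ≠ b := by
    rintro rfl
    exact hb (ha _ (mem_ball_self hρ))
  have hd : a - b ≠ 0 := sub_ne_zero.2 hab
  have hr : 0 < ‖a - b‖ := norm_pos_iff.2 hd
  set r := ‖a - b‖ with hrdef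
  obtain ⟨M, hM⟩ := exists_bound hu ht (isCompact_sphere b r)
  obtain ⟨x, hx⟩ : ∃ x : ℝ, u b = x := ⟨(u b).toReal, (EReal.coe_toReal (ht b) hb).symm⟩
  set τ : ℝ := ρ / (2 * r) with hτ
  have hτ0 : 0 < τ := by positivity
  obtain ⟨δ, hδ0, hδ⟩ : ∃ δ : ℝ, 0 < δ ∧ δ < min (min τ (τ ^ 2 / 4)) (1 / 2) :=
    exists_between (by positivity)
  have hδ1 : δ < τ := hδ.trans_le ((min_le_left _ _).trans (min_le_left _ _))
  have hδ2 : δ < τ ^ 2 / 4 := hδ.trans_le ((min_le_left _ _).trans (min_le_right _ _))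
  have hδ3 : δ < 1 / 2 := hδ.trans_le (min_le_right _ _)
  set s : ℝ := 1 - δ with hs
  have hs0 : 0 < s := by linarith
  have hs1 : s < 1 := by linarith
  set K : ℝ := max 0 (2 * (M - x) + 2) with hK
  have hK0 : 0 ≤ K := le_max_left _ _
  let F : ℂ → ℂ := fun z => ((M + K / 2 : ℝ) : ℂ) -
    (K : ℂ) * ((1 + s * ((z - b) / (a - b))) / (1 - s * ((z - b) / (a - b))))
  have hre : ∀ z, (F z).re = M + K / 2 - K * ((1 - s ^ 2 * ‖(z - b) / (a - b)‖ ^ 2) /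
      ‖1 - s * ((z - b) / (a - b))‖ ^ 2) := by
    intro z
    simp only [F, sub_re, ofReal_re, re_ofReal_mul, herglotz_re]
  have hsub := sub_le_re hu (c := b) (r := r) (R := r / s) hr (by
    rw [lt_div_iff₀ hs0]; nlinarith) (F := F) (by
    intro z hz
    have : 1 - s * ((z - b) / (a - b)) ≠ 0 := by
      intro h0
      have h1 : ‖(s : ℂ) * ((z - b) / (a - b))‖ = 1 := by
        rw [← sub_eq_zero.1 h0, norm_one]
      rw [norm_mul, norm_div, norm_real, Real.norm_of_nonneg hs0.le, ← hrdef] at h1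
      rw [mem_ball, dist_eq_norm, lt_div_iff₀ hs0] at hz
      field_simp at h1
      linarith
    apply DifferentiableAt.differentiableWithinAt
    fun_prop (disch := assumption)) (by
    intro z hz
    by_cases hza : z ∈ ball a ρ
    · rw [ha z hza]; exact bot_le
    · refine (hM z hz).le.trans ?_
      rw [hre]
      have hz1 : ‖(z - b) / (a - b)‖ = 1 := by
        rw [mem_sphere, dist_eq_norm] at hz
        rw [norm_div, hz, div_self hr.ne']
      rw [hz1]
      have h2 : τ ≤ ‖1 - s * ((z - b) / (a - b))‖ := by
        have h3 : 2 * τ ≤ ‖1 - (z - b) / (a - b)‖ := by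
          have : 1 - (z - b) / (a - b) = (a - z) / (a - b) := by field_simp; ring
          rw [this, norm_div, ← hrdef, ← dist_eq_norm, dist_comm]
          rw [mem_ball, not_lt] at hza
          rw [hτ, le_div_iff₀ hr]
          field_simp
          exact hza
        have h4 : ‖1 - (z - b) / (a - b)‖ ≤ ‖1 - s * ((z - b) / (a - b))‖ + δ := by
          have : 1 - (z - b) / (a - b) = (1 - s * ((z - b) / (a - b))) -
            (δ : ℂ) * ((z - b) / (a - b)) := by
            rw [hs]; push_cast; ring
          rw [this]
          refine (norm_sub_le _ _).trans ?_
          rw [norm_mul (δ : ℂ), hz1, norm_real, Real.norm_of_nonneg hδ0.le, mul_one]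
        linarith
      have h5 : (1 - s ^ 2 * 1 ^ 2) / ‖1 - s * ((z - b) / (a - b))‖ ^ 2 ≤ 1 / 2 := by
        rw [div_le_iff₀ (pow_pos (hτ0.trans_le h2) 2)]
        have : τ ^ 2 ≤ ‖1 - s * ((z - b) / (a - b))‖ ^ 2 := by gcongr
        nlinarith
      have h6 := mul_le_mul_of_nonneg_left h5 hK0
      exact_mod_cast (by linarith))
  rw [hx, hre] at hsub
  have h7 : x ≤ M + K / 2 - K := by
    have := EReal.coe_le_coe_iff.1 hsub
    simpa using this
  have : 2 * (M - x) + 2 ≤ K := le_max_right _ _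
  linarith

/-- Maximum principle with a subharmonic correction. -/
lemma max_principle {u : ℂ → EReal} (hu : SubharmonicOn u univ) (ht : ∀ z, u z ≠ ⊤)
    (hnb : ∃ z, u z ≠ ⊥) {φ : ℂ → ℝ} (hφ : ContinuousOn φ (closedBall 0 1))
    (hloc : ∀ z ∈ ball (0 : ℂ) 1, u z ≠ ⊥ → ∃ G : ℂ → ℂ, ∃ ρ > 0,
      DifferentiableOn ℂ G (ball z ρ) ∧ ∀ w ∈ ball z ρ, φ w = (G w).re)
    (hbd : ∀ z ∈ sphere (0 : ℂ) 1, φ z ≤ 0) :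
    ∀ z ∈ ball (0 : ℂ) 1, φ z ≤ 0 := by
  intro z₂ hz₂
  by_contra hpos
  push Not at hpos
  -- a nearby point where `u` is finite
  obtain ⟨z₁, hz₁, hφ₁, hu₁⟩ : ∃ z₁ ∈ ball (0 : ℂ) 1, 0 < φ z₁ ∧ u z₁ ≠ ⊥ := by
    by_contra hno
    push Not at hno
    have hc : ContinuousAt φ z₂ := (hφ z₂ (ball_subset_closedBall hz₂)).continuousAt
      (Filter.mem_of_superset (isOpen_ball.mem_nhds hz₂) ball_subset_closedBall)
    have hev : ∀ᶠ z in 𝓝 z₂, z ∈ ball (0 : ℂ) 1 ∧ 0 < φ z :=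
      (isOpen_ball.eventually_mem hz₂).and (hc.eventually (lt_mem_nhds hpos))
    obtain ⟨ρ, hρ, h⟩ := Metric.eventually_nhds_iff_ball.1 hev
    obtain ⟨b, hb⟩ := hnb
    exact hb (eq_bot_of_ball hu ht hρ (fun z hz => hno z (h z hz).1 (h z hz).2) b)
  obtain ⟨M, hM⟩ := exists_bound hu ht (isCompact_closedBall (0 : ℂ) 1)
  obtain ⟨x, hx⟩ : ∃ x : ℝ, u z₁ = x := ⟨(u z₁).toReal, (EReal.coe_toReal (ht _) hu₁).symm⟩
  obtain ⟨K, hK⟩ : ∃ K : ℝ, K * φ z₁ = M + 2 - x := ⟨(M + 2 - x) / φ z₁, by field_simp⟩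
  have hxM : x < M := by
    have := hM z₁ (ball_subset_closedBall hz₁)
    rw [hx] at this
    exact_mod_cast this
  have hK0 : 0 ≤ K := by
    by_contra h
    push Not at h
    nlinarith
  let ψ : ℂ → ℝ := fun z => K * φ z + ‖z‖ ^ 2 - 1 - M
  have hψc : ContinuousOn ψ (closedBall 0 1) := by
    have : Continuous fun z : ℂ => ‖z‖ := continuous_norm
    fun_prop
  have husc : UpperSemicontinuousOn (fun z => (ψ z : EReal) + u z) (closedBall 0 1) := by
    refine UpperSemicontinuousOn.add' ?_ (hu.1.mono (subset_univ _)) ?_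
    · exact (continuous_coe_real_ereal.comp_continuousOn hψc).upperSemicontinuousOn
    · intro z _
      exact EReal.continuousAt_add (Or.inl (EReal.coe_ne_top _)) (Or.inl (EReal.coe_ne_bot _))
  obtain ⟨z₀, hz₀, hmax⟩ := husc.exists_isMaxOn ⟨z₁, ball_subset_closedBall hz₁⟩
    (isCompact_closedBall _ _)
  have hmax' : ∀ z ∈ closedBall (0 : ℂ) 1, (ψ z : EReal) + u z ≤ (ψ z₀ : EReal) + u z₀ :=
    fun z hz => hmax hz
  have h₁ : (0 : EReal) < (ψ z₁ : EReal) + u z₁ := by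
    rw [hx]
    have : 0 < ψ z₁ + x := by
      simp only [ψ, hK]; nlinarith [norm_nonneg z₁]
    exact_mod_cast this
  have h₀ := h₁.trans_le (hmax' z₁ (ball_subset_closedBall hz₁))
  have hu₀ : u z₀ ≠ ⊥ := by
    intro h
    rw [h, EReal.add_bot] at h₀
    exact not_lt_bot h₀
  obtain ⟨y, hy⟩ : ∃ y : ℝ, u z₀ = y := ⟨(u z₀).toReal, (EReal.coe_toReal (ht _) hu₀).symm⟩
  have hyM : y < M := by
    have := hM z₀ hz₀
    rw [hy] at this
    exact_mod_cast this
  have h₀' : 0 < ψ z₀ + y := by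
    rw [hy] at h₀
    exact_mod_cast h₀
  have hz₀b : z₀ ∈ ball (0 : ℂ) 1 := by
    by_contra hnot
    have h1 : ‖z₀‖ = 1 := by
      simp only [mem_ball, mem_closedBall, dist_zero_right, not_lt] at hnot hz₀
      linarith
    have h2 := hbd z₀ (by simpa using h1)
    simp only [ψ, h1] at h₀'
    nlinarith
  obtain ⟨G, ρ, hρ, hG, hGφ⟩ := hloc z₀ hz₀b hu₀
  obtain ⟨σ, hσ, hσb⟩ := Metric.isOpen_iff.1 isOpen_ball z₀ hz₀b
  obtain ⟨s, hs0, hs⟩ : ∃ s : ℝ, 0 < s ∧ s < min ρ σ := exists_between (by positivity)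
  have hsρ : s < ρ := hs.trans_le (min_le_left _ _)
  have hsσ : s < σ := hs.trans_le (min_le_right _ _)
  let H : ℂ → ℂ := fun w => ((y - s ^ 2 : ℝ) : ℂ) - K * (G w - G z₀) -
    2 * (starRingEnd ℂ z₀) * (w - z₀)
  have hH : DifferentiableOn ℂ H (ball z₀ ρ) := by
    simp only [H]
    fun_prop
  have := sub_le_re hu hs0 hsρ hH (by
    intro w hw
    have hwσ : w ∈ ball z₀ σ := by rw [mem_ball, mem_sphere.1 hw]; exact hsσ
    have hwρ : w ∈ ball z₀ ρ := by rw [mem_ball, mem_sphere.1 hw]; exact hsρ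
    have h3 := hmax' w (ball_subset_closedBall (hσb hwσ))
    by_cases hbw : u w = ⊥
    · rw [hbw]; exact bot_le
    obtain ⟨v, hv⟩ : ∃ v : ℝ, u w = v := ⟨(u w).toReal, (EReal.coe_toReal (ht _) hbw).symm⟩
    rw [hv, hy] at h3
    rw [hv]
    have h4 : ψ w + v ≤ ψ z₀ + y := by exact_mod_cast h3
    have h5 : ‖w - z₀‖ ^ 2 = s ^ 2 := by rw [← dist_eq_norm, mem_sphere.1 hw]
    have h6 : v ≤ (H w).re := by
      simp only [ψ, hGφ w hwρ, hGφ z₀ (mem_ball_self hρ)] at h4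
      simp only [H, sub_re, ofReal_re, re_ofReal_mul]
      rw [← normSq_eq_norm_sq, normSq_apply] at h5 h4
      rw [← normSq_eq_norm_sq, normSq_apply] at h4
      simp only [mul_re, mul_im, conj_re, conj_im, sub_re, sub_im, re_ofNat, im_ofNat] at h5 ⊢
      nlinarith
    exact_mod_cast h6)
  rw [hy] at this
  have h8 : y ≤ (H z₀).re := by exact_mod_cast this
  simp [H] at h8
  have : 0 < s ^ 2 := by positivity
  have h9 : ((s : ℂ) ^ 2).re = s ^ 2 := by rw [← ofReal_pow, ofReal_re]
  linarith

/-- Trigonometric approximation on the unit circle. -/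
lemma trig_approx {φ : ℂ → ℝ} (hφ : ContinuousOn φ (sphere 0 1)) {η : ℝ} (hη : 0 < η) :
    ∃ h : ℂ → ℂ, Differentiable ℂ h ∧ ∀ z ∈ sphere (0 : ℂ) 1, |φ z - (h z).re| ≤ η := by
  have : Fact (0 < 2 * Real.pi) := ⟨Real.two_pi_pos⟩
  let e : AddCircle (2 * Real.pi) → ℂ := fun x => (AddCircle.toCircle x : ℂ)
  have he : ∀ x, e x ∈ sphere (0 : ℂ) 1 := fun x => by simpa [e] using Circle.norm_coe _
  have hec : Continuous e := continuous_subtype_val.comp AddCircle.continuous_toCircle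
  let Φ : C(AddCircle (2 * Real.pi), ℂ) := ⟨fun x => (φ (e x) : ℂ),
    continuous_ofReal.comp (hφ.comp_continuous hec he)⟩
  have hmem : Φ ∈ (Submodule.span ℂ (range (@fourier (2 * Real.pi)))).topologicalClosure := by
    rw [span_fourier_closure_eq_top]; trivial
  rw [← SetLike.mem_coe, Submodule.topologicalClosure_coe, Metric.mem_closure_iff] at hmem
  obtain ⟨T, hT, hdist⟩ := hmem η hη
  have hre : ∀ T ∈ Submodule.span ℂ (range (@fourier (2 * Real.pi))), ∀ c : ℂ, ∃ h : ℂ → ℂ,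
      Differentiable ℂ h ∧ ∀ x, (c * T x).re = (h (e x)).re := by
    intro T hT
    induction hT using Submodule.span_induction with
    | zero => exact fun c => ⟨fun _ => 0, by fun_prop, by simp⟩
    | add S T _ _ hS hT =>
      intro c
      obtain ⟨h, hd, hh⟩ := hS c
      obtain ⟨k, kd, kh⟩ := hT c
      refine ⟨fun z => h z + k z, by fun_prop, fun x => ?_⟩
      rw [add_re, ← hh, ← kh, ContinuousMap.add_apply, mul_add, add_re]
    | mem S hS =>
      intro c
      obtain ⟨n, rfl⟩ := hS
      obtain ⟨m, rfl | rfl⟩ := n.eq_nat_or_neg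
      · refine ⟨fun z => c * z ^ m, by fun_prop, fun x => ?_⟩
        simp [fourier_apply, e, AddCircle.toCircle_nsmul]
      · refine ⟨fun z => (starRingEnd ℂ c) * z ^ m, by fun_prop, fun x => ?_⟩
        rw [fourier_neg]
        simp [fourier_apply, e, AddCircle.toCircle_nsmul, -map_pow]
    | smul d S _ hS =>
      intro c
      obtain ⟨h, hd, hh⟩ := hS (c * d)
      exact ⟨h, hd, fun x => by rw [← hh]; simp [mul_assoc]⟩
  obtain ⟨h, hd, hh⟩ := hre T hT 1
  simp only [one_mul] at hh
  refine ⟨h, hd, fun z hz => ?_⟩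
  obtain ⟨x, rfl⟩ : ∃ x, e x = z := by
    have hz' : ‖z‖ = 1 := by simpa using hz
    obtain ⟨x, hx⟩ := (AddCircle.homeomorphCircle (T := 2 * Real.pi)
      Real.two_pi_pos.ne').surjective (⟨z, by simpa [Submonoid.unitSphere] using hz'⟩ : Circle)
    refine ⟨x, ?_⟩
    have := congrArg (fun c : Circle => (c : ℂ)) hx
    rw [AddCircle.homeomorphCircle_apply] at this
    exact this
  rw [← hh]
  have h1 : ‖Φ x - T x‖ < η := by
    rw [← dist_eq_norm]
    exact (ContinuousMap.dist_apply_le_dist x).trans_lt hdist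
  have h2 := (abs_re_le_norm (Φ x - T x)).trans h1.le
  simpa [Φ] using h2

lemma re_poisson {h : ℂ → ℂ} (hh : Differentiable ℂ h) {w : ℂ} (hw : w ∈ ball (0 : ℂ) 1) :
    Real.circleAverage ((Complex.re ∘ herglotzRieszKernel 0 w) • (fun z => (h z).re)) 0 1
      = (h w).re := by
  have h1 := (hh.diffContOnCl (s := ball (0 : ℂ) 1)).circleAverage_poissonKernel_smul hw
  rw [poissonKernel_eq_re_herglotzRieszKernel] at h1
  rw [← h1, ← reCLM_apply, ← Complex.reCLM.circleAverage_comp_comm]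
  · congr 1
    ext z
    simp
  · apply ContinuousOn.circleIntegrable'
    apply ContinuousOn.smul
    · exact continuous_re.comp_continuousOn (continuousOn_herglotzRieszKernel_sphere hw)
    · exact hh.continuous.continuousOn

lemma kernel_nonneg {w z : ℂ} (hw : w ∈ ball (0 : ℂ) 1) (hz : z ∈ sphere (0 : ℂ) 1) :
    0 ≤ (Complex.re ∘ herglotzRieszKernel 0 w) z := by
  rw [← poissonKernel_eq_re_herglotzRieszKernel, poissonKernel_def]
  have h1 : ‖z‖ = 1 := by simpa using hz
  have h2 : ‖w‖ < 1 := by simpa using hw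
  simp only [sub_zero, h1]
  have := norm_nonneg w
  apply div_nonneg _ (by positivity)
  nlinarith

lemma exists_holo {u : ℂ → EReal} (hu : SubharmonicOn u univ) (ht : ∀ z, u z ≠ ⊤)
    (hnb : ∃ z, u z ≠ ⊥) {φ : ℂ → ℝ} (hφ : ContinuousOn φ (closedBall 0 1))
    (hloc : ∀ z ∈ ball (0 : ℂ) 1, u z ≠ ⊥ → ∃ G : ℂ → ℂ, ∃ ρ > 0,
      DifferentiableOn ℂ G (ball z ρ) ∧ ∀ w ∈ ball z ρ, φ w = (G w).re) :
    ∃ S : ℂ → ℂ, DifferentiableOn ℂ S (ball 0 1) ∧ ∀ w ∈ ball (0 : ℂ) 1, φ w = (S w).re := by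
  have hφs : ContinuousOn φ (sphere 0 |1|) := by
    rw [abs_one]; exact hφ.mono sphere_subset_closedBall
  have hci : CircleIntegrable φ 0 1 := hφs.circleIntegrable'
  have hci' : CircleIntegrable (fun z => (φ z : ℂ)) 0 1 :=
    (continuous_ofReal.comp_continuousOn hφs).circleIntegrable'
  refine ⟨_, differentiableOn_circleAverage_herglotzRieszKernel_smul hci', fun w hw => ?_⟩
  rw [re_circleAverage_herglotzRieszKernel_smul hci hw]
  set P := Real.circleAverage ((Complex.re ∘ herglotzRieszKernel 0 w) • φ) 0 1
  have hker : ContinuousOn (Complex.re ∘ herglotzRieszKernel 0 w) (sphere 0 |1|) :=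
    continuous_re.comp_continuousOn (continuousOn_herglotzRieszKernel_sphere hw)
  have hint : ∀ g : ℂ → ℝ, ContinuousOn g (sphere 0 |1|) →
      CircleIntegrable ((Complex.re ∘ herglotzRieszKernel 0 w) • g) 0 1 := fun g hg =>
    ContinuousOn.circleIntegrable' (hker.smul hg)
  have hall : ∀ η : ℝ, 0 < η → |φ w - P| ≤ 2 * η := by
    intro η hη
    obtain ⟨h, hd, hh⟩ := trig_approx (hφ.mono sphere_subset_closedBall) hη
    have hhc := hd.continuous
    -- maximum principle
    have m1 := max_principle hu ht hnb (φ := fun z => φ z - (h z).re - η) (by fun_prop) (by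
      intro z hz huz
      obtain ⟨G, ρ, hρ, hG, hGφ⟩ := hloc z hz huz
      refine ⟨fun w => G w - h w - (η : ℂ), ρ, hρ, by fun_prop, fun w hw => ?_⟩
      simp [hGφ w hw]) (fun z hz => by
        have := (abs_le.1 (hh z hz)).2
        linarith) w hw
    have m2 := max_principle hu ht hnb (φ := fun z => (h z).re - φ z - η) (by fun_prop) (by
      intro z hz huz
      obtain ⟨G, ρ, hρ, hG, hGφ⟩ := hloc z hz huz
      refine ⟨fun w => h w - G w - (η : ℂ), ρ, hρ, by fun_prop, fun w hw => ?_⟩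
      simp [hGφ w hw]) (fun z hz => by
        have := (abs_le.1 (hh z hz)).1
        linarith) w hw
    -- Poisson integral comparison
    have q1 : P ≤ (h w + (η : ℂ)).re := by
      rw [← re_poisson (h := fun z => h z + (η : ℂ)) (by fun_prop) hw]
      refine Real.circleAverage_mono (hint _ hφs) (hint _ (by fun_prop)) fun z hz => ?_
      rw [abs_one] at hz
      have := (abs_le.1 (hh z hz)).2
      simp only [Pi.smul_apply', smul_eq_mul]
      apply mul_le_mul_of_nonneg_left _ (kernel_nonneg hw hz)
      simp; linarith
    have q2 : (h w - (η : ℂ)).re ≤ P := by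
      rw [← re_poisson (h := fun z => h z - (η : ℂ)) (by fun_prop) hw]
      refine Real.circleAverage_mono (hint _ (by fun_prop)) (hint _ hφs) fun z hz => ?_
      rw [abs_one] at hz
      have := (abs_le.1 (hh z hz)).1
      simp only [Pi.smul_apply', smul_eq_mul]
      apply mul_le_mul_of_nonneg_left _ (kernel_nonneg hw hz)
      simp; linarith
    simp only [add_re, sub_re, ofReal_re] at q1 q2
    rw [abs_le]
    constructor <;> linarith
  by_contra hne
  have hpos : 0 < |φ w - P| := abs_pos.2 (sub_ne_zero.2 hne)
  have := hall (|φ w - P| / 4) (by positivity)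
  linarith

lemma deriv_zero_of_conj {Q : ℂ → ℂ} {z : ℂ} (h1 : DifferentiableAt ℂ Q z)
    (h2 : DifferentiableAt ℂ (fun w => (starRingEnd ℂ) (Q w)) z) : deriv Q z = 0 := by
  have e1 := (h1.hasDerivAt.hasFDerivAt.restrictScalars ℝ)
  have e2 := (h2.hasDerivAt.hasFDerivAt.restrictScalars ℝ)
  have e3 := (conjCLE : ℂ →L[ℝ] ℂ).hasFDerivAt.comp z e1
  have e4 := e3.unique e2
  have a1 := congrArg (fun L : ℂ →L[ℝ] ℂ => L 1) e4
  have a2 := congrArg (fun L : ℂ →L[ℝ] ℂ => L I) e4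
  simp at a1 a2
  rw [← a1] at a2
  have : (starRingEnd ℂ) (deriv Q z) = 0 := by
    have h3 : I * (starRingEnd ℂ) (deriv Q z) = 0 := by linear_combination (-1 / 2) * a2
    simpa using h3
  simpa using this

/-- The one-dimensional theorem on the unit disc. -/
lemma one_dim {u : ℂ → EReal} (hu : SubharmonicOn u univ) (ht : ∀ z, u z ≠ ⊤)
    (hnb : ∃ z, u z ≠ ⊥) {g : ℂ → ℂ} (hg : ContinuousOn g (closedBall 0 1))
    (hloc : ∀ z ∈ ball (0 : ℂ) 1, u z ≠ ⊥ → ∀ᶠ w in 𝓝 z, DifferentiableAt ℂ g w) :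
    DifferentiableOn ℂ g (ball 0 1) := by
  obtain ⟨S, hS, hgS⟩ := exists_holo hu ht hnb (φ := fun z => (g z).re)
    (continuous_re.comp_continuousOn hg) (by
      intro z hz huz
      obtain ⟨ρ, hρ, h⟩ := Metric.eventually_nhds_iff_ball.1 (hloc z hz huz)
      exact ⟨g, ρ, hρ, fun w hw => (h w hw).differentiableWithinAt, fun _ _ => rfl⟩)
  obtain ⟨T, hT, hgT⟩ := exists_holo hu ht hnb (φ := fun z => (g z).im)
    (continuous_im.comp_continuousOn hg) (by
      intro z hz huz
      obtain ⟨ρ, hρ, h⟩ := Metric.eventually_nhds_iff_ball.1 (hloc z hz huz)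
      exact ⟨fun w => -I * g w, ρ, hρ, fun w hw =>
        ((h w hw).const_mul _).differentiableWithinAt, fun _ _ => by simp⟩)
  let P : ℂ → ℂ := fun z => (S z + I * T z) / 2
  let Q : ℂ → ℂ := fun z => (S z - I * T z) / 2
  have hP : DifferentiableOn ℂ P (ball 0 1) := by simp only [P]; fun_prop
  have hQ : DifferentiableOn ℂ Q (ball 0 1) := by simp only [Q]; fun_prop
  have hdec : ∀ z ∈ ball (0 : ℂ) 1, g z = P z + (starRingEnd ℂ) (Q z) := by
    intro z hz
    apply Complex.ext
    · rw [hgS z hz, add_re, conj_re]; simp [P, Q]; ring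
    · rw [hgT z hz, add_im, conj_im]; simp [P, Q]; ring
  obtain ⟨z₁, hz₁, hu₁⟩ : ∃ z ∈ ball (0 : ℂ) 1, u z ≠ ⊥ := by
    by_contra hno
    push Not at hno
    obtain ⟨b, hb⟩ := hnb
    exact hb (eq_bot_of_ball hu ht one_pos hno b)
  have hev : ∀ᶠ w in 𝓝 z₁, deriv Q w = 0 := by
    filter_upwards [hloc z₁ hz₁ hu₁, isOpen_ball.eventually_mem hz₁] with w hw hwb
    have hnh := isOpen_ball.mem_nhds hwb
    refine deriv_zero_of_conj (hQ.differentiableAt hnh) ?_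
    refine (hw.sub (hP.differentiableAt hnh)).congr_of_eventuallyEq ?_
    filter_upwards [hnh] with v hv
    simp [hdec v hv]
  have hzero : EqOn (deriv Q) 0 (ball 0 1) :=
    (hQ.deriv isOpen_ball).analyticOnNhd isOpen_ball
      |>.eqOn_of_preconnected_of_eventuallyEq analyticOnNhd_const
        (convex_ball _ _).isPreconnected hz₁ hev
  have hconst : ∀ z ∈ ball (0 : ℂ) 1, Q z = Q 0 := fun z hz =>
    isOpen_ball.is_const_of_deriv_eq_zero (convex_ball _ _).isPreconnected hQ hzero hz
      (mem_ball_self one_pos)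
  refine (hP.add_const ((starRingEnd ℂ) (Q 0))).congr fun z hz => ?_
  rw [hdec z hz, hconst z hz]

/-- Second order Taylor bound on the unit disc. -/
lemma taylor_bound {g : ℂ → ℂ} {M : ℝ} (hd : DifferentiableOn ℂ g (ball 0 1))
    (hM : ∀ t ∈ ball (0 : ℂ) 1, ‖g t‖ ≤ M) {d : ℂ} (hder : HasDerivAt g d 0) (hdM : ‖d‖ ≤ M)
    {t : ℂ} (ht : t ∈ ball (0 : ℂ) 1) : ‖g t - g 0 - t * d‖ ≤ 3 * M * ‖t‖ ^ 2 := by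
  let h : ℂ → ℂ := fun t => g t - t * d
  have h0 : h 0 = g 0 := by simp [h]
  have key := Complex.dist_le_mul_div_pow_of_mapsTo_ball_of_isLittleO (f := h) (c := 0) (z := t)
    (R₁ := 1) (R₂ := 3 * M) (n := 1) (by simp only [h]; fun_prop) (by
      intro s hs
      rw [mem_closedBall, dist_eq_norm, h0]
      have h1 : ‖s‖ < 1 := by simpa using hs
      have h2 : ‖s * d‖ ≤ M := by
        rw [norm_mul]; nlinarith [norm_nonneg s, norm_nonneg d]
      calc ‖g s - s * d - g 0‖ ≤ ‖g s - s * d‖ + ‖g 0‖ := norm_sub_le _ _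
        _ ≤ ‖g s‖ + ‖s * d‖ + ‖g 0‖ := by gcongr; exact norm_sub_le _ _
        _ ≤ 3 * M := by linarith [hM s hs, hM 0 (by simp)]) (by
      have h3 := hasDerivAt_iff_isLittleO.1 hder
      refine (h3.norm_right).congr (fun s => ?_) (fun s => ?_)
      · simp [h]; ring
      · simp) ht
  rw [dist_eq_norm, h0, dist_zero_right, div_one] at key
  refine le_trans (le_of_eq ?_) key
  congr 1
  simp only [h]; ring

lemma psh_dense {n : ℕ} {u : (Fin n → ℂ) → EReal} (hu : Plurisubharmonic u)
    (hnb : ¬ ∀ z, u z = ⊥) : Dense {z | u z ≠ ⊥} := by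
  rw [Metric.dense_iff]
  intro a ρ hρ
  by_contra hno
  push Not at hno
  obtain ⟨b, hb⟩ := not_forall.1 hnb
  have hall : ∀ z ∈ ball a ρ, u z = ⊥ := by
    intro z hz
    by_contra hz'
    have : z ∈ ball a ρ ∩ {z | u z ≠ ⊥} := ⟨hz, hz'⟩
    simp [hno] at this
  have hcont : ContinuousAt (fun t : ℂ => a + t • (b - a)) 0 := by fun_prop
  have hev : ∀ᶠ t in 𝓝 (0 : ℂ), a + t • (b - a) ∈ ball a ρ :=
    hcont.eventually (isOpen_ball.eventually_mem (by simpa using hρ))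
  obtain ⟨σ, hσ, h⟩ := Metric.eventually_nhds_iff_ball.1 hev
  have := eq_bot_of_ball (hu.2.2 a (b - a)) (fun t => hu.2.1 _) hσ
    (fun t ht => hall _ (h t ht)) 1
  simp at this
  exact hb this

lemma main_aux {n : ℕ} (D B : Set (Fin n → ℂ))
    (hDopen : IsOpen D) (hBclosed : closure B ∩ D ⊆ B) (hBpolar : Pluripolar B)
    (f : (Fin n → ℂ) → ℂ) (hf : ContinuousOn f D)
    (hol : DifferentiableOn ℂ f (D \ B)) :
    DifferentiableOn ℂ f D := by
  obtain ⟨u, hu, hnb, huB⟩ := hBpolar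
  have hopen : IsOpen (D \ B) := by
    have : D \ B = D \ closure B := by
      ext z
      constructor
      · exact fun h => ⟨h.1, fun hc => h.2 (hBclosed ⟨hc, h.1⟩)⟩
      · exact fun h => ⟨h.1, fun hc => h.2 (subset_closure hc)⟩
    rw [this]
    exact hDopen.sdiff isClosed_closure
  intro a₀ ha₀
  apply DifferentiableAt.differentiableWithinAt
  obtain ⟨ρ₀, hρ₀, hball₀⟩ := Metric.isOpen_iff.1 hDopen a₀ ha₀
  obtain ⟨ρ, hρ, hρ'⟩ : ∃ ρ : ℝ, 0 < ρ ∧ 2 * ρ < ρ₀ := ⟨ρ₀ / 4, by positivity, by linarith⟩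
  have hball : closedBall a₀ (2 * ρ) ⊆ D := (closedBall_subset_ball hρ').trans hball₀
  obtain ⟨M, hM⟩ := (isCompact_closedBall a₀ (2 * ρ)).exists_bound_of_continuousOn
    (hf.mono hball)
  -- estimates at good points
  have hgood : ∀ a ∈ ball a₀ ρ, u a ≠ ⊥ → ∃ L : (Fin n → ℂ) →L[ℂ] ℂ, ‖L‖ ≤ M / ρ ∧
      ∀ v, ‖v‖ < ρ → ‖f (a + v) - f a - L v‖ ≤ 3 * M / ρ ^ 2 * ‖v‖ ^ 2 := by
    intro a ha hua
    have haD : ∀ (b : Fin n → ℂ), ‖b‖ ≤ ρ → ∀ t ∈ closedBall (0 : ℂ) 1,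
        a + t • b ∈ closedBall a₀ (2 * ρ) := by
      intro b hb t ht
      have ht' : ‖t‖ ≤ 1 := by simpa using ht
      rw [mem_ball, dist_eq_norm] at ha
      rw [mem_closedBall, dist_eq_norm]
      calc ‖a + t • b - a₀‖ = ‖(a - a₀) + t • b‖ := by congr 1; abel
        _ ≤ ‖a - a₀‖ + ‖t‖ * ‖b‖ := (norm_add_le _ _).trans (by rw [norm_smul])
        _ ≤ 2 * ρ := by nlinarith [norm_nonneg b, norm_nonneg t]
    have haDB : ∀ z ∈ D, u z ≠ ⊥ → ∀ᶠ w in 𝓝 z, DifferentiableAt ℂ f w := by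
      intro z hz huz
      have hzDB : z ∈ D \ B := ⟨hz, fun h => huz (huB z h)⟩
      filter_upwards [hopen.mem_nhds hzDB] with w hw
      exact hol.differentiableAt (hopen.mem_nhds hw)
    have haD0 : a ∈ D := hball (by simpa using haD 0 (by simpa using hρ.le) 0 (by simp))
    have hfd : DifferentiableAt ℂ f a := (haDB a haD0 hua).self_of_nhds
    have hline : ∀ b : Fin n → ℂ, ‖b‖ ≤ ρ →
        DifferentiableOn ℂ (fun t : ℂ => f (a + t • b)) (ball 0 1) := by
      intro b hb
      refine one_dim (hu.2.2 a b) (fun t => hu.2.1 _) ⟨0, by simpa using hua⟩ ?_ ?_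
      · exact (hf.mono hball).comp (by fun_prop) (fun t ht => haD b hb t ht)
      · intro t ht hut
        have h1 := haDB _ (hball (haD b hb t (ball_subset_closedBall ht))) hut
        have hcont : ContinuousAt (fun t : ℂ => a + t • b) t := by fun_prop
        filter_upwards [hcont.eventually h1] with w hw
        exact DifferentiableAt.comp w hw (by fun_prop)
    have hder : ∀ b : Fin n → ℂ, HasDerivAt (fun t : ℂ => f (a + t • b)) (fderiv ℂ f a b) 0 := by
      intro b
      have h1 : HasDerivAt (fun t : ℂ => a + t • b) b 0 := by
        simpa using ((hasDerivAt_id (0 : ℂ)).smul_const b).const_add a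
      have h2 : HasFDerivAt f (fderiv ℂ f a) (a + (0 : ℂ) • b) := by
        simpa using hfd.hasFDerivAt
      exact h2.comp_hasDerivAt 0 h1
    have hbM : ∀ b : Fin n → ℂ, ‖b‖ ≤ ρ → ∀ t ∈ ball (0 : ℂ) 1, ‖f (a + t • b)‖ ≤ M :=
      fun b hb t ht => hM _ (haD b hb t (ball_subset_closedBall ht))
    have hLb : ∀ b : Fin n → ℂ, ‖b‖ ≤ ρ → ‖fderiv ℂ f a b‖ ≤ M := by
      intro b hb
      rw [← (hder b).deriv]
      have h1 := Complex.norm_deriv_le_of_forall_mem_sphere_norm_le (c := 0) (R := 1) (C := M)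
        (f := fun t : ℂ => f (a + t • b)) one_pos
        ⟨hline b hb, by
          rw [closure_ball _ one_ne_zero]
          exact (hf.mono hball).comp (by fun_prop) (fun t ht => haD b hb t ht)⟩
        (fun t ht => hM _ (haD b hb t (sphere_subset_closedBall ht)))
      simpa using h1
    have hM0 : 0 ≤ M := (norm_nonneg _).trans (hLb 0 (by simpa using hρ.le))
    -- rescaling
    have hscale : ∀ v : Fin n → ℂ, v ≠ 0 → ∃ b : Fin n → ℂ, ‖b‖ = ρ ∧
        v = ((‖v‖ / ρ : ℝ) : ℂ) • b := by
      intro v hv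
      have hv' : 0 < ‖v‖ := norm_pos_iff.2 hv
      refine ⟨((ρ / ‖v‖ : ℝ) : ℂ) • v, ?_, ?_⟩
      · rw [norm_smul, norm_real, Real.norm_of_nonneg (by positivity)]
        field_simp
      · rw [smul_smul, ← ofReal_mul]
        have : ‖v‖ / ρ * (ρ / ‖v‖) = 1 := by field_simp
        rw [this]; simp
    refine ⟨fderiv ℂ f a, ?_, ?_⟩
    · refine ContinuousLinearMap.opNorm_le_bound _ (by positivity) fun v => ?_
      by_cases hv : v = 0
      · simp [hv]
      obtain ⟨b, hb, hvb⟩ := hscale v hv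
      have h1 := hLb b hb.le
      calc ‖fderiv ℂ f a v‖ = ‖v‖ / ρ * ‖fderiv ℂ f a b‖ := by
            conv_lhs => rw [hvb]
            rw [map_smul, norm_smul, norm_real, Real.norm_of_nonneg (by positivity)]
        _ ≤ ‖v‖ / ρ * M := by gcongr
        _ = M / ρ * ‖v‖ := by ring
    · intro v hvρ
      by_cases hv : v = 0
      · simp [hv]
      obtain ⟨b, hb, hvb⟩ := hscale v hv
      have htn : ‖((‖v‖ / ρ : ℝ) : ℂ)‖ = ‖v‖ / ρ := by
        rw [norm_real, Real.norm_of_nonneg (by positivity)]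
      have h1 := taylor_bound (hline b hb.le) (hbM b hb.le) (hder b) (hLb b hb.le)
        (t := ((‖v‖ / ρ : ℝ) : ℂ)) (by
          rw [mem_ball, dist_zero_right, htn, div_lt_one hρ]; exact hvρ)
      rw [htn, ← smul_eq_mul, ← map_smul, ← hvb, zero_smul, add_zero] at h1
      refine h1.trans (le_of_eq ?_)
      field_simp
  -- limit
  have hdense := psh_dense hu hnb
  obtain ⟨s, hs, hslim⟩ := mem_closure_iff_seq_limit.1 (hdense a₀)
  have hs_ev : ∀ᶠ k in atTop, s k ∈ ball a₀ ρ :=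
    hslim.eventually (isOpen_ball.eventually_mem (mem_ball_self hρ))
  obtain ⟨N, hN⟩ := eventually_atTop.1 hs_ev
  have hslim' : Tendsto (fun k => s (k + N)) atTop (𝓝 a₀) := (tendsto_add_atTop_iff_nat N).2 hslim
  choose L hLn hLt using fun k => hgood (s (k + N)) (hN _ (Nat.le_add_left _ _)) (hs _)
  obtain ⟨Λ, -, κ, hκ, hΛ⟩ := (isCompact_closedBall (0 : (Fin n → ℂ) →L[ℂ] ℂ) (M / ρ)).tendsto_subseq
    (x := L) (fun k => by simpa using hLn k)
  have hs2 : Tendsto (fun k => s (κ k + N)) atTop (𝓝 a₀) := hslim'.comp hκ.tendsto_atTop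
  have hbound : ∀ v, ‖v‖ < ρ → ‖f (a₀ + v) - f a₀ - Λ v‖ ≤ 3 * M / ρ ^ 2 * ‖v‖ ^ 2 := by
    intro v hv
    have hmem : a₀ + v ∈ D := hball (by
      rw [mem_closedBall, dist_eq_norm, add_sub_cancel_left]; linarith)
    have c1 : Tendsto (fun k => f (s (κ k + N) + v)) atTop (𝓝 (f (a₀ + v))) :=
      (hf.continuousAt (hDopen.mem_nhds hmem)).tendsto.comp (hs2.add_const v)
    have c2 : Tendsto (fun k => f (s (κ k + N))) atTop (𝓝 (f a₀)) :=
      (hf.continuousAt (hDopen.mem_nhds ha₀)).tendsto.comp hs2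
    have c3 : Tendsto (fun k => L (κ k) v) atTop (𝓝 (Λ v)) :=
      ((ContinuousLinearMap.apply ℂ ℂ v).continuous.tendsto Λ).comp hΛ
    exact le_of_tendsto ((c1.sub c2).sub c3).norm (Eventually.of_forall fun k => hLt (κ k) v hv)
  have : HasFDerivAt f Λ a₀ := by
    rw [hasFDerivAt_iff_isLittleO_nhds_zero]
    have hO : (fun v => f (a₀ + v) - f a₀ - Λ v) =O[𝓝 0] fun v : Fin n → ℂ => ‖v‖ ^ 2 := by
      refine Asymptotics.IsBigO.of_bound (3 * M / ρ ^ 2) ?_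
      filter_upwards [ball_mem_nhds (0 : Fin n → ℂ) hρ] with v hv
      rw [norm_pow, norm_norm]
      exact hbound v (by simpa using hv)
    refine hO.trans_isLittleO ?_
    exact Asymptotics.isLittleO_norm_pow_id one_lt_two
  exact this.differentiableAt

end helpers

/-- A continuous function on a domain `D ⊆ ℂⁿ` which is holomorphic off a relatively
closed pluripolar subset `B ⊆ D` is holomorphic on all of `D`. -/
theorem holomorphic_across_closed_pluripolar
    {n : ℕ} (D B : Set (Fin n → ℂ))
    (hDopen : IsOpen D) (hDconn : IsConnected D)
    (hBD : B ⊆ D) (hBclosed : closure B ∩ D ⊆ B) (hBpolar : Pluripolar B)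
    (f : (Fin n → ℂ) → ℂ) (hf : ContinuousOn f D)
    (hol : DifferentiableOn ℂ f (D \ B)) :
    DifferentiableOn ℂ f D := by
  exact main_aux D B hDopen hBclosed hBpolar f hf hol
end
end
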